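/- Let I be a Cartwright-Sturmfels ideal of S and let L be a Z^v-graded linear form of S. Then I + (L) is a Cartwright-Sturmfels ideal of S and the image of I + (L) in S/(L) is a Cartwright-Sturmfels ideal of S/(L). Moreover, if U_i ⊆ S_{e_i} are K-vector subspaces for i = 1,...,v and R = K[U_1,...,U_v] is the Z^v-graded polynomial subring of S they generate, then I ∩ R is a Cartwright-Sturmfels ideal of R. -/

import Mathlib

open MvPolynomial

noncomputable section

namespace CSPaper

/-- The set of variables of the standard `ℤ^v`-graded polynomial ring `S`:
the variable `x_{i j}` of the paper (with `1 ≤ i ≤ v`, `1 ≤ j ≤ n_i`) corresponds to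
`⟨i-1, j-1⟩ : MVar v n` where `n (i-1) = n_i - 1`; thus row `i` has `n i + 1 > 0`
variables and the first variable `x_{i 1}` of row `i` corresponds to `⟨i, 0⟩`. -/
abbrev MVar (v : ℕ) (n : Fin v → ℕ) : Type := Σ i : Fin v, Fin (n i + 1)

/-- The weight function giving the standard `ℤ^v`-grading: `deg (x_{i j}) = e_i ∈ ℤ^v`. -/
def wt (v : ℕ) (n : Fin v → ℕ) : MVar v n → (Fin v → ℕ) := fun p => Pi.single p.1 1

variable {K : Type} [Field K] {v : ℕ} {n : Fin v → ℕ}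

/-- An ideal of `S` is `ℤ^v`-graded (multigraded) iff it contains every multihomogeneous
component of each of its elements. -/
def IsMultigraded (I : Ideal (MvPolynomial (MVar v n) K)) : Prop :=
  ∀ f ∈ I, ∀ a : Fin v → ℕ, weightedHomogeneousComponent (wt v n) a f ∈ I

/-- The value of the `ℤ^v`-graded Hilbert function of the ideal `I` at `a ∈ ℕ^v`:
`dim_K I_a`. -/
def hilb (I : Ideal (MvPolynomial (MVar v n) K)) (a : Fin v → ℕ) : ℕ :=
  Module.finrank K
    ((Submodule.restrictScalars K I ⊓ weightedHomogeneousSubmodule K (wt v n) a :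
      Submodule K (MvPolynomial (MVar v n) K)))

/-- Two ideals have the same `ℤ^v`-graded Hilbert series. -/
def sameHS (I J : Ideal (MvPolynomial (MVar v n) K)) : Prop :=
  ∀ a : Fin v → ℕ, hilb I a = hilb J a

/-- The `ℤ^v`-graded `K`-algebra endomorphism of `S` determined by a `v`-tuple of square
matrices: `x_{i j} ↦ ∑_k (g i)_{k j} x_{i k}`.  For invertible `g i` these are exactly the
elements of `G = GL_{n_1}(K) × ⋯ × GL_{n_v}(K)` acting on `S`. -/
def gAct (g : ∀ i : Fin v, Matrix (Fin (n i + 1)) (Fin (n i + 1)) K) :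
    MvPolynomial (MVar v n) K →ₐ[K] MvPolynomial (MVar v n) K :=
  aeval fun p : MVar v n => ∑ k : Fin (n p.1 + 1), C (g p.1 k p.2) * X ⟨p.1, k⟩

/-- A property `P` of `v`-tuples of matrices holds generically (i.e. for a general
`g ∈ GL_{n_1}(K) × ⋯ × GL_{n_v}(K)`) if there is a nonzero polynomial `h` in the matrix
entries such that `P g` holds for every invertible `g` with `h(g) ≠ 0`. -/
def Generically
    (P : (∀ i : Fin v, Matrix (Fin (n i + 1)) (Fin (n i + 1)) K) → Prop) : Prop :=
  ∃ h : MvPolynomial (Σ i : Fin v, Fin (n i + 1) × Fin (n i + 1)) K, h ≠ 0 ∧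
    ∀ g : ∀ i : Fin v, Matrix (Fin (n i + 1)) (Fin (n i + 1)) K,
      (∀ i, IsUnit (g i).det) →
      eval (fun q : Σ i : Fin v, Fin (n i + 1) × Fin (n i + 1) => g q.1 q.2.1 q.2.2) h ≠ 0 →
      P g

/-- The leading exponent (exponent of the leading monomial) of a polynomial with respect to
a term order `τ` (a `MonomialOrder`); by convention `leadExp τ 0 = 0`. -/
def leadExp (τ : MonomialOrder (MVar v n)) (f : MvPolynomial (MVar v n) K) :
    MVar v n →₀ ℕ :=
  τ.toSyn.symm (f.support.sup τ.toSyn)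

/-- The initial ideal `in_τ(I)`: the monomial ideal generated by the leading monomials of the
nonzero elements of `I`. -/
def inIdeal (τ : MonomialOrder (MVar v n)) (I : Ideal (MvPolynomial (MVar v n) K)) :
    Ideal (MvPolynomial (MVar v n) K) :=
  Ideal.span {m | ∃ f ∈ I, f ≠ 0 ∧ m = monomial (leadExp τ f) (1 : K)}

/-- `G` is a Gröbner basis of `I` with respect to the term order `τ`. -/
def IsGroebnerBasis (τ : MonomialOrder (MVar v n)) (G : Set (MvPolynomial (MVar v n) K))
    (I : Ideal (MvPolynomial (MVar v n) K)) : Prop :=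
  G ⊆ (I : Set (MvPolynomial (MVar v n) K)) ∧
    Ideal.span ((fun f => monomial (leadExp τ f) (1 : K)) '' {f ∈ G | f ≠ 0}) = inIdeal τ I

/-- `J = gin_τ(I)`, the `ℤ^v`-graded generic initial ideal: for a general
`g ∈ GL_{n_1}(K) × ⋯ × GL_{n_v}(K)` one has `in_τ(g(I)) = J`. -/
def IsGin (τ : MonomialOrder (MVar v n)) (I J : Ideal (MvPolynomial (MVar v n) K)) : Prop :=
  Generically fun g => inIdeal τ (Ideal.map (gAct g) I) = J

/-- A term order such that `x_{i j} > x_{i k}` whenever `j < k`. -/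
def RespectsVarOrder (τ : MonomialOrder (MVar v n)) : Prop :=
  ∀ (i : Fin v) (j k : Fin (n i + 1)), j < k →
    τ.toSyn (Finsupp.single (⟨i, k⟩ : MVar v n) 1) <
      τ.toSyn (Finsupp.single (⟨i, j⟩ : MVar v n) 1)

/-- An ideal is Borel fixed if it is fixed by every element of the Borel subgroup
`B = B_{n_1}(K) × ⋯ × B_{n_v}(K)` of upper triangular invertible matrices (upper triangular
with respect to the order `x_{i 1} > x_{i 2} > ⋯` of the variables in each row). -/
def BorelFixed (I : Ideal (MvPolynomial (MVar v n) K)) : Prop :=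
  ∀ g : ∀ i : Fin v, Matrix (Fin (n i + 1)) (Fin (n i + 1)) K,
    (∀ i, IsUnit (g i).det) →
    (∀ (i : Fin v) (k j : Fin (n i + 1)), j < k → g i k j = 0) →
    Ideal.map (gAct g) I = I

/-- A Cartwright-Sturmfels ideal: a `ℤ^v`-graded ideal with the same `ℤ^v`-graded Hilbert
series as some radical Borel fixed ideal. -/
def IsCS (I : Ideal (MvPolynomial (MVar v n) K)) : Prop :=
  IsMultigraded I ∧ ∃ J : Ideal (MvPolynomial (MVar v n) K),
    J.IsRadical ∧ BorelFixed J ∧ sameHS I J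

/-- The exponent of the monomial `x_{1 1}^{a 1} ⋯ x_{v 1}^{a v}` of
`T = K[x_{1 1}, …, x_{v 1}] ⊆ S`. -/
def Tmono (v : ℕ) (n : Fin v → ℕ) (a : Fin v → ℕ) : MVar v n →₀ ℕ :=
  ∑ i : Fin v, Finsupp.single (⟨i, 0⟩ : MVar v n) (a i)

/-- A `ℤ^v`-graded ideal of `S` extended from `T`, i.e. generated by monomials in the
variables `x_{1 1}, …, x_{v 1}`. -/
def ExtendedFromT (J : Ideal (MvPolynomial (MVar v n) K)) : Prop :=
  ∃ A : Set (Fin v → ℕ),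
    J = Ideal.span ((fun a => monomial (Tmono v n a) (1 : K)) '' A)

/-- A Cartwright-Sturmfels* ideal: a `ℤ^v`-graded ideal with the same `ℤ^v`-graded Hilbert
series as some ideal extended from `T`. -/
def IsCSstar (J : Ideal (MvPolynomial (MVar v n) K)) : Prop :=
  IsMultigraded J ∧ ∃ C : Ideal (MvPolynomial (MVar v n) K), ExtendedFromT C ∧ sameHS J C

/-- A monomial ideal. -/
def IsMonomialIdeal (I : Ideal (MvPolynomial (MVar v n) K)) : Prop :=
  ∃ A : Set (MVar v n →₀ ℕ), I = Ideal.span ((fun s => monomial s (1 : K)) '' A)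

/-- A squarefree monomial ideal. -/
def IsSqfreeMonomialIdeal (I : Ideal (MvPolynomial (MVar v n) K)) : Prop :=
  ∃ A : Set (MVar v n →₀ ℕ), (∀ s ∈ A, ∀ x, s x ≤ 1) ∧
    I = Ideal.span ((fun s => monomial s (1 : K)) '' A)

/-- `J` is the Alexander dual of the squarefree monomial ideal `I`: `J` is generated by the
products `∏_{x ∈ P} x` as `P` ranges over the minimal primes of `I`. -/
def IsAlexanderDual (I J : Ideal (MvPolynomial (MVar v n) K)) : Prop :=
  J = Ideal.span {m | ∃ F : Finset (MVar v n),
    Ideal.span ((fun x => (X x : MvPolynomial (MVar v n) K)) '' ↑F) ∈ I.minimalPrimes ∧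
    m = ∏ x ∈ F, X x}

/-- The sequence `x_{i j} - λ_{i j} x_{i 1}`, `1 ≤ i ≤ v`, `2 ≤ j ≤ n_i`, as a list. -/
def LamList (lam : MVar v n → K) : List (MvPolynomial (MVar v n) K) :=
  (List.finRange v).flatMap fun i =>
    ((List.finRange (n i + 1)).drop 1).map fun j =>
      X (⟨i, j⟩ : MVar v n) - C (lam ⟨i, j⟩) * X (⟨i, 0⟩ : MVar v n)

/-- A property of the scalars `λ = (λ_{i j})` holds for general `λ ∈ K^N` if there is a
nonzero polynomial `h` in the `λ_{i j}` such that the property holds whenever `h(λ) ≠ 0`. -/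
def GenericallyLam {v : ℕ} {n : Fin v → ℕ} (K : Type) [Field K]
    (P : (MVar v n → K) → Prop) : Prop :=
  ∃ h : MvPolynomial (MVar v n) K, h ≠ 0 ∧
    ∀ lam : MVar v n → K, eval lam h ≠ 0 → P lam

variable {K : Type} [Field K] {v : ℕ} {n : Fin v → ℕ}

/-- A graded free resolution of an ideal `I` of a polynomial ring graded by an additive
monoid `M` via a weight function `w` on the variables:
`⋯ → F_2 → F_1 → F_0 → I → 0`, where `F_p` is the free module with (finite) basis `ι p`,
the basis element `i : ι p` having degree `deg p i ∈ M`, all maps are graded of degree `0`,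
and the complex is exact. -/
structure GradedFreeResolution (σ : Type) (K : Type) [Field K] (M : Type) [AddCommMonoid M]
    (w : σ → M) (I : Ideal (MvPolynomial σ K)) where
  ι : ℕ → Type
  finite : ∀ p, Finite (ι p)
  deg : ∀ p, ι p → M
  aug : (ι 0 →₀ MvPolynomial σ K) →ₗ[MvPolynomial σ K] MvPolynomial σ K
  d : ∀ p, (ι (p + 1) →₀ MvPolynomial σ K) →ₗ[MvPolynomial σ K] (ι p →₀ MvPolynomial σ K)
  aug_graded : ∀ i : ι 0, (aug (Finsupp.single i 1)).IsWeightedHomogeneous w (deg 0 i)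
  d_graded : ∀ (p : ℕ) (i : ι (p + 1)) (j : ι p),
    (d p (Finsupp.single i 1)) j = 0 ∨
      ∃ b, ((d p (Finsupp.single i 1)) j).IsWeightedHomogeneous w b ∧
        b + deg p j = deg (p + 1) i
  range_aug : LinearMap.range aug = (I : Submodule (MvPolynomial σ K) (MvPolynomial σ K))
  exact_zero : LinearMap.ker aug = LinearMap.range (d 0)
  exact : ∀ p, LinearMap.ker (d p) = LinearMap.range (d (p + 1))

/-- A graded free resolution is minimal if all entries of the matrices of the differentials
between free modules lie in the irrelevant maximal ideal, i.e. have zero constant term. -/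
def GradedFreeResolution.Minimal {σ M : Type} [AddCommMonoid M] {w : σ → M}
    {I : Ideal (MvPolynomial σ K)} (F : GradedFreeResolution σ K M w I) : Prop :=
  ∀ (p : ℕ) (i : F.ι (p + 1)) (j : F.ι p),
    MvPolynomial.constantCoeff ((F.d p (Finsupp.single i 1)) j) = 0

/-- The graded Betti number `β_{p,a}` read off from a (minimal) graded free resolution:
the number of basis elements of `F_p` of degree `a`. -/
def GradedFreeResolution.betti {σ M : Type} [AddCommMonoid M] {w : σ → M}
    {I : Ideal (MvPolynomial σ K)} (F : GradedFreeResolution σ K M w I) (p : ℕ) (a : M) :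
    ℕ :=
  Nat.card {i : F.ι p // F.deg p i = a}

/-- The set of `t × t` minors of the matrix `A`. -/
def minorsSet {R : Type} [CommRing R] (t : ℕ) {m N : ℕ} (A : Matrix (Fin m) (Fin N) R) :
    Set R :=
  {d | ∃ (r : Fin t → Fin m) (c : Fin t → Fin N),
    Function.Injective r ∧ Function.Injective c ∧ d = (A.submatrix r c).det}

/-- `I_t(A)`, the ideal generated by the `t × t` minors of `A`. -/
def minorsIdeal {R : Type} [CommRing R] (t : ℕ) {m N : ℕ}
    (A : Matrix (Fin m) (Fin N) R) : Ideal R :=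
  Ideal.span (minorsSet t A)

/-- `A` is column-graded: `N ≤ v` and each entry of the `j`-th column is either `0` or
multihomogeneous of degree `e_j ∈ ℤ^v`. -/
def ColumnGraded {m N : ℕ} (A : Matrix (Fin m) (Fin N) (MvPolynomial (MVar v n) K)) :
    Prop :=
  ∃ h : N ≤ v, ∀ i j, A i j = 0 ∨
    (A i j).IsWeightedHomogeneous (wt v n) (Pi.single (Fin.castLE h j) 1)

/-- `A` is row-graded: `m ≤ v` and each entry of the `i`-th row is either `0` or
multihomogeneous of degree `e_i ∈ ℤ^v`. -/
def RowGraded {m N : ℕ} (A : Matrix (Fin m) (Fin N) (MvPolynomial (MVar v n) K)) : Prop :=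
  ∃ h : m ≤ v, ∀ i j, A i j = 0 ∨
    (A i j).IsWeightedHomogeneous (wt v n) (Pi.single (Fin.castLE h i) 1)

/-- The exponent of the polarization of the monomial `x_{1 1}^{a 1} ⋯ x_{v 1}^{a v}` of `T`:
the squarefree monomial `∏_i x_{i 1} x_{i 2} ⋯ x_{i (a i)}`. -/
def polExp (v : ℕ) (n : Fin v → ℕ) (a : Fin v → ℕ) : MVar v n →₀ ℕ :=
  ∑ i : Fin v, ∑ j ∈ Finset.univ.filter (fun j : Fin (n i + 1) => (j : ℕ) < a i),
    Finsupp.single (⟨i, j⟩ : MVar v n) 1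

/-- `P = pol(C)`, the polarization of an ideal `C` extended from `T`
(the exponents of the generators of `C` must fit inside `S`). -/
def IsPolarizationOfT (C P : Ideal (MvPolynomial (MVar v n) K)) : Prop :=
  ∃ A : Set (Fin v → ℕ), (∀ a ∈ A, ∀ i, a i ≤ n i + 1) ∧
    C = Ideal.span ((fun a => monomial (Tmono v n a) (1 : K)) '' A) ∧
    P = Ideal.span ((fun a => monomial (polExp v n a) (1 : K)) '' A)

/-- `ψ` is an identification of the quotient of `S` by the `ℤ^v`-graded ideal `Q` with a
standard `ℤ^v`-graded polynomial ring, compatible with the gradings. -/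
def IsGradedStructureIso {n₂ : Fin v → ℕ} (Q : Ideal (MvPolynomial (MVar v n) K))
    (ψ : (MvPolynomial (MVar v n) K ⧸ Q) ≃ₐ[K] MvPolynomial (MVar v n₂) K) : Prop :=
  ∀ (f : MvPolynomial (MVar v n) K) (a : Fin v → ℕ),
    f.IsWeightedHomogeneous (wt v n) a →
      (ψ (Ideal.Quotient.mk Q f)).IsWeightedHomogeneous (wt v n₂) a

end CSPaper

namespace CSPaper

section Basics

variable {K : Type} [Field K] {v : ℕ} {σ : Type}

/-- The weight of a variable lying in row `r s`. -/
def rowWt (r : σ → Fin v) : σ → (Fin v → ℕ) := fun s => Pi.single (r s) 1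

/-- The space of forms of degree `a`. -/
abbrev homSub (K : Type) [Field K] (r : σ → Fin v) (a : Fin v → ℕ) :
    Submodule K (MvPolynomial σ K) :=
  weightedHomogeneousSubmodule K (rowWt r) a

/-- The degree `a` part of an ideal. -/
abbrev hPart (r : σ → Fin v) (I : Ideal (MvPolynomial σ K)) (a : Fin v → ℕ) :
    Submodule K (MvPolynomial σ K) :=
  Submodule.restrictScalars K I ⊓ homSub K r a

/-- The Hilbert function of the quotient by `I`. -/
def hf (r : σ → Fin v) (I : Ideal (MvPolynomial σ K)) (a : Fin v → ℕ) : ℕ :=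
  Module.finrank K (homSub K r a) - Module.finrank K (hPart r I a)

/-- Multigraded ideals. -/
def MG (r : σ → Fin v) (I : Ideal (MvPolynomial σ K)) : Prop :=
  ∀ f ∈ I, ∀ a : Fin v → ℕ, weightedHomogeneousComponent (rowWt r) a f ∈ I

lemma weight_rowWt_apply [Finite σ] (r : σ → Fin v) (d : σ →₀ ℕ) (s : σ) :
    d s ≤ Finsupp.weight (rowWt r) d (r s) := by
  classical
  rw [Finsupp.weight_apply, Finsupp.sum, Finset.sum_apply]
  by_cases h : s ∈ d.support
  · refine le_trans ?_ (Finset.single_le_sum (f := fun c => (d c • rowWt r c) (r s))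
      (fun _ _ => Nat.zero_le _) h)
    simp [rowWt]
  · simp at h
    simp [h]

lemma finite_weight [Finite σ] (r : σ → Fin v) (a : Fin v → ℕ) :
    {d : σ →₀ ℕ | Finsupp.weight (rowWt r) d = a}.Finite := by
  classical
  have := Fintype.ofFinite σ
  refine (Set.finite_Iic (Finsupp.equivFunOnFinite.symm fun s => a (r s))).subset ?_
  intro d hd s
  have := weight_rowWt_apply r d s
  rw [Set.mem_ofPred_eq] at hd
  rw [hd] at this
  simpa using this

instance homSub_finite [Finite σ] (r : σ → Fin v) (a : Fin v → ℕ) :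
    Module.Finite K (homSub K r a) := by
  rw [homSub, weightedHomogeneousSubmodule_eq_finsupp_supported]
  have := (finite_weight r a).to_subtype
  exact Module.Finite.equiv (AddMonoidAlgebra.supportedEquivFinsupp (R := K) (S := K)
    {d : σ →₀ ℕ | Finsupp.weight (rowWt r) d = a}).symm

instance hPart_finite [Finite σ] (r : σ → Fin v) (I : Ideal (MvPolynomial σ K))
    (a : Fin v → ℕ) : Module.Finite K (hPart r I a) :=
  Submodule.finiteDimensional_of_le (inf_le_right : hPart r I a ≤ homSub K r a)

lemma mem_homSub {r : σ → Fin v} {a : Fin v → ℕ} {f : MvPolynomial σ K} :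
    f ∈ homSub K r a ↔ f.IsWeightedHomogeneous (rowWt r) a := Iff.rfl

lemma X_mem_homSub (r : σ → Fin v) (s : σ) :
    (X s : MvPolynomial σ K) ∈ homSub K r (Pi.single (r s) 1) :=
  isWeightedHomogeneous_X _ _ _

lemma mul_mem_homSub {r : σ → Fin v} {a b : Fin v → ℕ} {f g : MvPolynomial σ K}
    (hf : f ∈ homSub K r a) (hg : g ∈ homSub K r b) : f * g ∈ homSub K r (a + b) :=
  IsWeightedHomogeneous.mul hf hg

lemma hPart_mono {r : σ → Fin v} {I J : Ideal (MvPolynomial σ K)} (h : I ≤ J)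
    (a : Fin v → ℕ) : hPart r I a ≤ hPart r J a :=
  inf_le_inf_right _ h

lemma finrank_hPart_add_hf [Finite σ] (r : σ → Fin v) (I : Ideal (MvPolynomial σ K))
    (a : Fin v → ℕ) :
    Module.finrank K (hPart r I a) + hf r I a = Module.finrank K (homSub K r a) :=
  Nat.add_sub_of_le (Submodule.finrank_mono inf_le_right)

lemma hf_congr {r : σ → Fin v} {I J : Ideal (MvPolynomial σ K)} {a : Fin v → ℕ}
    (h : hPart r I a = hPart r J a) : hf r I a = hf r J a := by
  rw [hf, hf, h]

lemma hPart_eq_of_hf_le [Finite σ] {r : σ → Fin v} {I J : Ideal (MvPolynomial σ K)}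
    (h : I ≤ J) {a : Fin v → ℕ} (ha : hf r I a ≤ hf r J a) : hPart r I a = hPart r J a := by
  have h1 := finrank_hPart_add_hf r I a
  have h2 := finrank_hPart_add_hf r J a
  have h3 := Submodule.finrank_mono (hPart_mono (r := r) h a)
  exact Submodule.eq_of_le_of_finrank_le (hPart_mono h a) (by omega)

lemma hf_eq_zero_iff [Finite σ] {r : σ → Fin v} {I : Ideal (MvPolynomial σ K)}
    {a : Fin v → ℕ} : hf r I a = 0 ↔ ∀ f ∈ homSub K r a, f ∈ I := by
  constructor
  · intro h f hf'
    have : hPart r I a = hPart r ⊤ a := hPart_eq_of_hf_le le_top (by omega)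
    have h2 : f ∈ hPart r ⊤ a := ⟨trivial, hf'⟩
    rw [← this] at h2
    exact h2.1
  · intro h
    have : hPart r I a = homSub K r a := inf_eq_right.2 h
    rw [hf, this, Nat.sub_self]

/-- Homogeneous elements determine a multigraded colon condition. -/
lemma component_mul_add {r : σ → Fin v} {z f : MvPolynomial σ K} {e b : Fin v → ℕ}
    (hz : z ∈ homSub K r e) :
    weightedHomogeneousComponent (rowWt r) (b + e) (z * f) =
      z * weightedHomogeneousComponent (rowWt r) b f := by
  classical
  let _ := weightedGradedAlgebra K (rowWt r)
  have := DirectSum.coe_decompose_mul_add_of_left_mem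
    (weightedHomogeneousSubmodule K (rowWt r)) (i := e) (j := b) (b := f) hz
  rw [add_comm b e, ← weightedDecomposition.decompose'_apply K (rowWt r),
    ← weightedDecomposition.decompose'_apply K (rowWt r)]
  exact this

lemma component_mul_of_not_le {r : σ → Fin v} {z f : MvPolynomial σ K} {e b : Fin v → ℕ}
    (hz : z ∈ homSub K r e) (h : ¬ e ≤ b) :
    weightedHomogeneousComponent (rowWt r) b (z * f) = 0 := by
  classical
  let _ := weightedGradedAlgebra K (rowWt r)
  rw [← weightedDecomposition.decompose'_apply K (rowWt r)]
  exact DirectSum.coe_decompose_mul_of_left_mem_of_not_le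
    (weightedHomogeneousSubmodule K (rowWt r)) (i := e) (n := b) (b := f) hz h

/-- The colon ideal `I : z`. -/
def colon (I : Ideal (MvPolynomial σ K)) (z : MvPolynomial σ K) : Ideal (MvPolynomial σ K) :=
  Submodule.comap (LinearMap.mulLeft (MvPolynomial σ K) z) I

@[simp] lemma mem_colon {I : Ideal (MvPolynomial σ K)} {z f : MvPolynomial σ K} :
    f ∈ colon I z ↔ z * f ∈ I := Iff.rfl

lemma le_colon (I : Ideal (MvPolynomial σ K)) (z : MvPolynomial σ K) : I ≤ colon I z :=
  fun _ hf => I.mul_mem_left _ hf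

lemma MG.colon {r : σ → Fin v} {I : Ideal (MvPolynomial σ K)} (hI : MG r I)
    {z : MvPolynomial σ K} {e : Fin v → ℕ} (hz : z ∈ homSub K r e) : MG r (colon I z) := by
  intro f hf a
  have := hI _ hf (a + e)
  change weightedHomogeneousComponent (rowWt r) (a + e) (z * f) ∈ I at this
  rwa [component_mul_add hz] at this

lemma MG.sup {r : σ → Fin v} {I J : Ideal (MvPolynomial σ K)} (hI : MG r I) (hJ : MG r J) :
    MG r (I ⊔ J) := by
  intro f hf a
  obtain ⟨g, hg, h, hh, rfl⟩ := Submodule.mem_sup.1 hf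
  rw [map_add]
  exact Ideal.add_mem _ (Ideal.mem_sup_left (hI g hg a)) (Ideal.mem_sup_right (hJ h hh a))

lemma MG.span_singleton {r : σ → Fin v} {z : MvPolynomial σ K} {e : Fin v → ℕ}
    (hz : z ∈ homSub K r e) : MG r (Ideal.span {z}) := by
  intro f hf a
  obtain ⟨g, rfl⟩ := Ideal.mem_span_singleton'.1 hf
  rw [mul_comm]
  by_cases h : e ≤ a
  · obtain ⟨b, rfl⟩ := exists_add_of_le h
    rw [add_comm e b, component_mul_add hz]
    exact Ideal.mul_mem_right _ _ (Ideal.mem_span_singleton_self z)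
  · rw [component_mul_of_not_le hz h]
    exact Ideal.zero_mem _

lemma MG.sup_span {r : σ → Fin v} {I : Ideal (MvPolynomial σ K)} (hI : MG r I)
    {z : MvPolynomial σ K} {e : Fin v → ℕ} (hz : z ∈ homSub K r e) :
    MG r (I ⊔ Ideal.span {z}) :=
  hI.sup (MG.span_singleton hz)

/-- A homogeneous element of `I + (z)` splits homogeneously. -/
lemma exists_of_mem_sup {r : σ → Fin v} {I : Ideal (MvPolynomial σ K)} (hI : MG r I)
    {z : MvPolynomial σ K} {e b : Fin v → ℕ} (hz : z ∈ homSub K r e) {f : MvPolynomial σ K}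
    (hf : f ∈ homSub K r (b + e)) (hfI : f ∈ I ⊔ Ideal.span {z}) :
    ∃ g ∈ hPart r I (b + e), ∃ s ∈ homSub K r b, f = g + z * s := by
  obtain ⟨g, hg, h, hh, rfl⟩ := Submodule.mem_sup.1 hfI
  obtain ⟨s, rfl⟩ := Ideal.mem_span_singleton'.1 hh
  refine ⟨weightedHomogeneousComponent (rowWt r) (b + e) g,
    ⟨hI g hg _, weightedHomogeneousComponent_mem _ _ _⟩,
    weightedHomogeneousComponent (rowWt r) b s,
    weightedHomogeneousComponent_mem _ _ _, ?_⟩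
  rw [← component_mul_add hz, ← map_add, mul_comm z s]
  exact (IsWeightedHomogeneous.weightedHomogeneousComponent_same hf).symm

lemma hPart_sup_span_of_not_le {r : σ → Fin v} {I : Ideal (MvPolynomial σ K)} (hI : MG r I)
    {z : MvPolynomial σ K} {e a : Fin v → ℕ} (hz : z ∈ homSub K r e) (h : ¬ e ≤ a) :
    hPart r (I ⊔ Ideal.span {z}) a = hPart r I a := by
  refine le_antisymm ?_ (hPart_mono le_sup_left a)
  rintro f ⟨hf1, hf2⟩
  refine ⟨?_, hf2⟩
  obtain ⟨g, hg, h', hh, rfl⟩ := Submodule.mem_sup.1 hf1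
  obtain ⟨s, rfl⟩ := Ideal.mem_span_singleton'.1 hh
  have h3 := IsWeightedHomogeneous.weightedHomogeneousComponent_same hf2
  rw [map_add, mul_comm s z, component_mul_of_not_le hz h, add_zero, mul_comm z s] at h3
  rw [← h3]
  exact hI g hg a

lemma single_not_le {i : Fin v} {a : Fin v → ℕ} (h : a i = 0) :
    ¬ (Pi.single i 1 : Fin v → ℕ) ≤ a := fun h' => by
  have := h' i
  simp [h] at this

lemma hf_sup_span_of_eq_zero {r : σ → Fin v} {I : Ideal (MvPolynomial σ K)} (hI : MG r I)
    {z : MvPolynomial σ K} {i : Fin v} (hz : z ∈ homSub K r (Pi.single i 1))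
    {a : Fin v → ℕ} (h : a i = 0) :
    hf r (I ⊔ Ideal.span {z}) a = hf r I a :=
  hf_congr (hPart_sup_span_of_not_le hI hz (single_not_le h))

/-- Additivity of the Hilbert function along `0 → S/(I:z)(-e) → S/I → S/(I+z) → 0`. -/
lemma hf_add [Finite σ] {r : σ → Fin v} {I : Ideal (MvPolynomial σ K)} (hI : MG r I)
    {z : MvPolynomial σ K} {e : Fin v → ℕ} (hz : z ∈ homSub K r e) (b : Fin v → ℕ) :
    hf r I (b + e) = hf r (I ⊔ Ideal.span {z}) (b + e) + hf r (colon I z) b := by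
  by_cases hz0 : z = 0
  · subst hz0
    have : hf r (colon I (0 : MvPolynomial σ K)) b = 0 := by
      rw [hf_eq_zero_iff]
      intro f _
      simp
    rw [this]
    simp
  have hinj : Function.Injective (LinearMap.mulLeft K z) := fun x y h => by
    simpa [hz0] using h
  have e1 : hPart r (I ⊔ Ideal.span {z}) (b + e) =
      hPart r I (b + e) ⊔ (homSub K r b).map (LinearMap.mulLeft K z) := by
    refine le_antisymm ?_ (sup_le (hPart_mono le_sup_left _) ?_)
    · rintro f ⟨hf1, hf2⟩
      obtain ⟨g, hg, s, hs, rfl⟩ := exists_of_mem_sup hI hz hf2 hf1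
      exact Submodule.add_mem_sup hg ⟨s, hs, rfl⟩
    · rintro _ ⟨s, hs, rfl⟩
      refine ⟨Ideal.mem_sup_right (Ideal.mul_mem_right _ _ (Ideal.mem_span_singleton_self z)), ?_⟩
      rw [add_comm]
      exact mul_mem_homSub hz hs
  have e2 : hPart r I (b + e) ⊓ (homSub K r b).map (LinearMap.mulLeft K z) =
      (hPart r (colon I z) b).map (LinearMap.mulLeft K z) := by
    apply le_antisymm
    · rintro f ⟨hf1, s, hs, rfl⟩
      exact ⟨s, ⟨hf1.1, hs⟩, rfl⟩
    · rintro _ ⟨s, hs, rfl⟩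
      refine ⟨⟨hs.1, ?_⟩, s, hs.2, rfl⟩
      rw [add_comm]
      exact mul_mem_homSub hz hs.2
  have h1 := Submodule.finrank_sup_add_finrank_inf_eq (hPart r I (b + e))
    ((homSub K r b).map (LinearMap.mulLeft K z))
  rw [e2, ← e1, ← (Submodule.equivMapOfInjective _ hinj (homSub K r b)).finrank_eq,
    ← (Submodule.equivMapOfInjective _ hinj (hPart r (colon I z) b)).finrank_eq] at h1
  have h2 := finrank_hPart_add_hf r I (b + e)
  have h3 := finrank_hPart_add_hf r (I ⊔ Ideal.span {z}) (b + e)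
  have h4 := finrank_hPart_add_hf r (colon I z) b
  omega

end Basics

section Numeric

variable {v : ℕ}

/-- `rowF k a` is the number of monomials of degree `a` in a row whose smallest variable is in
position `k` from the end (`k = 0` meaning that the monomial is `1`). -/
def rowF : ℕ → ℕ → ℕ
  | 0, 0 => 1
  | 0, _ + 1 => 0
  | _ + 1, 0 => 0
  | k + 1, a + 1 => Nat.multichoose (k + 1) a

lemma rowF_succ_succ (k b : ℕ) :
    rowF (k + 1) (b + 1) = rowF (k + 1) b + (if k = 0 then rowF 0 b else rowF k (b + 1)) := by
  rcases k with _ | k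
  · rcases b with _ | b <;> simp [rowF]
  · rcases b with _ | b
    · simp [rowF]
    · simp only [rowF, Nat.add_eq_zero_iff, one_ne_zero, and_false, if_false]
      rw [Nat.multichoose_succ_succ, add_comm]

lemma rowF_zero_right {k : ℕ} (h : k ≠ 0) : rowF k 0 = 0 := by
  rcases k with _ | k
  · exact absurd rfl h
  · rfl

lemma rowF_zero_left {a : ℕ} (h : a ≠ 0) : rowF 0 a = 0 := by
  rcases a with _ | a
  · exact absurd rfl h
  · rfl

lemma rowF_pos {k a : ℕ} (h : k = 0 ↔ a = 0) : 0 < rowF k a := by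
  rcases k with _ | k <;> rcases a with _ | a <;> simp_all [rowF, Nat.multichoose_eq]
  exact Nat.choose_pos (by omega)

/-- The number of monomials of multidegree `a` of type `k`. -/
def boxG (k a : Fin v → ℕ) : ℕ := ∏ i, rowF (k i) (a i)

/-- The sum of `boxG k` over a finite set of types. -/
def sumG (Δ : Finset (Fin v → ℕ)) (a : Fin v → ℕ) : ℕ := ∑ k ∈ Δ, boxG k a

lemma boxG_pos {k a : Fin v → ℕ} (h : ∀ i, k i = 0 ↔ a i = 0) : 0 < boxG k a :=
  Finset.prod_pos fun i _ => rowF_pos (h i)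

lemma boxG_eq_zero_of_left {k a : Fin v → ℕ} {i : Fin v} (h : k i ≠ 0) (ha : a i = 0) :
    boxG k a = 0 :=
  Finset.prod_eq_zero (Finset.mem_univ i) (by rw [ha]; exact rowF_zero_right h)

lemma boxG_eq_zero_of_right {k a : Fin v → ℕ} {i : Fin v} (h : k i = 0) (ha : a i ≠ 0) :
    boxG k a = 0 :=
  Finset.prod_eq_zero (Finset.mem_univ i) (by rw [h]; exact rowF_zero_left ha)

lemma boxG_eq_zero_iff {k : Fin v → ℕ} : boxG k 0 ≠ 0 ↔ k = 0 := by
  constructor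
  · intro h
    by_contra hk
    obtain ⟨i, hi⟩ := Function.ne_iff.1 hk
    exact h (boxG_eq_zero_of_left hi rfl)
  · rintro rfl
    exact (boxG_pos (by simp)).ne'

lemma boxG_split (k a : Fin v → ℕ) (i : Fin v) :
    boxG k a = rowF (k i) (a i) * ∏ j ∈ Finset.univ.erase i, rowF (k j) (a j) :=
  (Finset.mul_prod_erase _ _ (Finset.mem_univ i)).symm

lemma boxG_split_of_eq {k a k' a' : Fin v → ℕ} {i : Fin v} (hk : ∀ j, j ≠ i → k' j = k j)
    (ha : ∀ j, j ≠ i → a' j = a j) :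
    boxG k' a' = rowF (k' i) (a' i) * ∏ j ∈ Finset.univ.erase i, rowF (k j) (a j) := by
  rw [boxG_split k' a' i]
  congr 1
  refine Finset.prod_congr rfl fun j hj => ?_
  rw [hk j (Finset.ne_of_mem_erase hj), ha j (Finset.ne_of_mem_erase hj)]

lemma boxG_add_of_ne {k b : Fin v → ℕ} {i : Fin v} (h : k i ≠ 0) :
    boxG (k + Pi.single i 1) (b + Pi.single i 1) =
      boxG k (b + Pi.single i 1) + boxG (k + Pi.single i 1) b := by
  have h1 : ∀ (c : Fin v → ℕ) j, j ≠ i → (c + Pi.single i 1 : Fin v → ℕ) j = c j := fun c j hj => by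
    simp [hj]
  rw [boxG_split_of_eq (h1 k) (h1 b), boxG_split_of_eq (fun _ _ => rfl) (h1 b),
    boxG_split_of_eq (h1 k) (fun _ _ => rfl)]
  simp only [Pi.add_apply, Pi.single_eq_same]
  rw [rowF_succ_succ, if_neg h]
  ring

lemma boxG_add_of_eq {k b : Fin v → ℕ} {i : Fin v} (h : k i = 0) :
    boxG (k + Pi.single i 1) (b + Pi.single i 1) =
      boxG k b + boxG (k + Pi.single i 1) b := by
  have h1 : ∀ (c : Fin v → ℕ) j, j ≠ i → (c + Pi.single i 1 : Fin v → ℕ) j = c j := fun c j hj => by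
    simp [hj]
  rw [boxG_split_of_eq (h1 k) (h1 b), boxG_split k b i,
    boxG_split_of_eq (h1 k) (fun _ _ => rfl)]
  simp only [Pi.add_apply, Pi.single_eq_same]
  rw [rowF_succ_succ, h, if_pos rfl]
  ring

lemma add_single_injective (i : Fin v) :
    Function.Injective fun k : Fin v → ℕ => k + Pi.single i 1 :=
  add_left_injective _

/-- Shifting down the types with `k i ≥ 2`. -/
def dropTwo (i : Fin v) (Δ : Finset (Fin v → ℕ)) : Finset (Fin v → ℕ) :=
  (Δ.filter fun k => 2 ≤ k i).image fun k => k - Pi.single i 1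

/-- Shifting down the types with `k i = 1`. -/
def dropOne (i : Fin v) (Δ : Finset (Fin v → ℕ)) : Finset (Fin v → ℕ) :=
  (Δ.filter fun k => k i = 1).image fun k => k - Pi.single i 1

lemma sub_add_single {k : Fin v → ℕ} {i : Fin v} (h : 1 ≤ k i) :
    k - Pi.single i 1 + Pi.single i 1 = k := by
  refine tsub_add_cancel_of_le fun j => ?_
  by_cases hj : j = i
  · subst hj; simpa using h
  · simp [hj]

lemma mem_dropTwo {i : Fin v} {Δ : Finset (Fin v → ℕ)} {k : Fin v → ℕ} :
    k ∈ dropTwo i Δ ↔ k + Pi.single i 1 ∈ Δ ∧ 1 ≤ k i := by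
  simp only [dropTwo, Finset.mem_image, Finset.mem_filter]
  constructor
  · rintro ⟨k', ⟨h1, h2⟩, rfl⟩
    rw [sub_add_single (by omega)]
    exact ⟨h1, by simp; omega⟩
  · rintro ⟨h1, h2⟩
    exact ⟨_, ⟨h1, by simp; omega⟩, add_tsub_cancel_right _ _⟩

lemma mem_dropOne {i : Fin v} {Δ : Finset (Fin v → ℕ)} {k : Fin v → ℕ} :
    k ∈ dropOne i Δ ↔ k + Pi.single i 1 ∈ Δ ∧ k i = 0 := by
  simp only [dropOne, Finset.mem_image, Finset.mem_filter]
  constructor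
  · rintro ⟨k', ⟨h1, h2⟩, rfl⟩
    rw [sub_add_single (by omega)]
    exact ⟨h1, by simp; omega⟩
  · rintro ⟨h1, h2⟩
    exact ⟨_, ⟨h1, by simp; omega⟩, add_tsub_cancel_right _ _⟩

lemma sub_single_injOn {i : Fin v} {s : Finset (Fin v → ℕ)} (h : ∀ k ∈ s, 1 ≤ k i) :
    Set.InjOn (fun k : Fin v → ℕ => k - Pi.single i 1) s := by
  intro k hk k' hk' hkk
  have := congrArg (fun k : Fin v → ℕ => k + Pi.single i 1) hkk
  simpa only [sub_add_single (h k hk), sub_add_single (h k' hk')] using this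

lemma sumG_split (Δ : Finset (Fin v → ℕ)) (i : Fin v) (b : Fin v → ℕ) :
    sumG Δ (b + Pi.single i 1) = sumG (dropTwo i Δ) (b + Pi.single i 1) +
      (sumG (Δ.filter fun k => 1 ≤ k i) b + sumG (dropOne i Δ) b) := by
  have e1 : sumG (dropTwo i Δ) (b + Pi.single i 1) =
      ∑ k ∈ Δ, if 2 ≤ k i then boxG (k - Pi.single i 1) (b + Pi.single i 1) else 0 := by
    rw [sumG, dropTwo, Finset.sum_image (sub_single_injOn (by
      intro k hk
      have := (Finset.mem_filter.1 hk).2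
      omega)), Finset.sum_filter]
  have e2 : sumG (dropOne i Δ) b =
      ∑ k ∈ Δ, if k i = 1 then boxG (k - Pi.single i 1) b else 0 := by
    rw [sumG, dropOne, Finset.sum_image (sub_single_injOn (by
      intro k hk
      have := (Finset.mem_filter.1 hk).2
      omega)), Finset.sum_filter]
  rw [e1, e2, sumG, sumG, Finset.sum_filter, ← Finset.sum_add_distrib, ← Finset.sum_add_distrib]
  refine Finset.sum_congr rfl fun k _ => ?_
  rcases Nat.lt_or_ge (k i) 1 with h | h
  · have h0 : k i = 0 := by omega
    rw [boxG_eq_zero_of_right h0 (by simp)]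
    simp [h0]
  · have hk := sub_add_single h
    have hki : k i = (k - Pi.single i 1 : Fin v → ℕ) i + 1 := by simp; omega
    rcases Nat.lt_or_ge (k i) 2 with h2 | h2
    · have h1 : k i = 1 := by omega
      have := boxG_add_of_eq (k := k - Pi.single i 1) (b := b) (i := i) (by omega)
      rw [hk] at this
      rw [this]
      simp [h1, add_comm]
    · have := boxG_add_of_ne (k := k - Pi.single i 1) (b := b) (i := i) (by omega)
      rw [hk] at this
      rw [this]
      have h1 : k i ≠ 1 := by omega
      simp [h1, h, h2]

lemma sumG_union {Δ Δ' : Finset (Fin v → ℕ)} (h : Disjoint Δ Δ') (a : Fin v → ℕ) :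
    sumG (Δ ∪ Δ') a = sumG Δ a + sumG Δ' a :=
  Finset.sum_union h

lemma sumG_eq_zero_of_right {Δ : Finset (Fin v → ℕ)} {i : Fin v} {a : Fin v → ℕ}
    (h : ∀ k ∈ Δ, k i = 0) (ha : a i ≠ 0) : sumG Δ a = 0 :=
  Finset.sum_eq_zero fun k hk => boxG_eq_zero_of_right (h k hk) ha

lemma sumG_eq_zero_of_left {Δ : Finset (Fin v → ℕ)} {i : Fin v} {a : Fin v → ℕ}
    (h : ∀ k ∈ Δ, k i ≠ 0) (ha : a i = 0) : sumG Δ a = 0 :=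
  Finset.sum_eq_zero fun k hk => boxG_eq_zero_of_left (h k hk) ha

lemma sumG_filter_add (Δ : Finset (Fin v → ℕ)) (i : Fin v) (a : Fin v → ℕ) :
    sumG (Δ.filter fun k => k i = 0) a + sumG (Δ.filter fun k => ¬ k i = 0) a = sumG Δ a :=
  Finset.sum_filter_add_sum_filter_not _ _ _

/-- The set of types of `Q` obtained from those of `Q + (z)` and `(Q : z) + (z)`. -/
def glue (i : Fin v) (Δ₀ Δ₁ : Finset (Fin v → ℕ)) : Finset (Fin v → ℕ) :=
  (Δ₀.filter fun k => k i = 0) ∪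
    ((Δ₁.filter fun k => k i = 0) ∪ (Δ₀.filter fun k => ¬ k i = 0)).image
      fun k => k + Pi.single i 1

lemma sumG_glue (i : Fin v) (Δ₀ Δ₁ : Finset (Fin v → ℕ)) (a : Fin v → ℕ) :
    sumG (glue i Δ₀ Δ₁) a = sumG (Δ₀.filter fun k => k i = 0) a +
      (∑ k ∈ Δ₁.filter (fun k => k i = 0), boxG (k + Pi.single i 1) a +
        ∑ k ∈ Δ₀.filter (fun k => ¬ k i = 0), boxG (k + Pi.single i 1) a) := by
  rw [glue, sumG_union, sumG, sumG, Finset.sum_image (add_single_injective i).injOn,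
    Finset.sum_union]
  · rw [Finset.disjoint_left]
    intro k hk hk'
    exact (Finset.mem_filter.1 hk').2 (Finset.mem_filter.1 hk).2
  · rw [Finset.disjoint_left]
    intro k hk hk'
    obtain ⟨k', _, rfl⟩ := Finset.mem_image.1 hk'
    have := (Finset.mem_filter.1 hk).2
    simp at this

lemma sumG_glue_zero (i : Fin v) (Δ₀ Δ₁ : Finset (Fin v → ℕ)) {a : Fin v → ℕ} (ha : a i = 0) :
    sumG (glue i Δ₀ Δ₁) a = sumG Δ₀ a := by
  have h0 : ∀ k : Fin v → ℕ, boxG (k + Pi.single i 1) a = 0 := fun k =>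
    boxG_eq_zero_of_left (i := i) (by simp) ha
  rw [sumG_glue, ← sumG_filter_add Δ₀ i a,
    sumG_eq_zero_of_left (Δ := Δ₀.filter fun k => ¬ k i = 0) (i := i)
      (fun k hk => (Finset.mem_filter.1 hk).2) ha]
  simp [h0]

lemma sumG_glue_succ (i : Fin v) (Δ₀ Δ₁ : Finset (Fin v → ℕ)) (b : Fin v → ℕ) :
    sumG (glue i Δ₀ Δ₁) (b + Pi.single i 1) = sumG Δ₀ (b + Pi.single i 1) +
      (if b i = 0 then sumG Δ₁ b else sumG (glue i Δ₀ Δ₁) b) := by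
  have h0 : ∀ k ∈ Δ₀.filter (fun k => k i = 0), k i = 0 := fun k hk => (Finset.mem_filter.1 hk).2
  have h0' : ∀ k ∈ Δ₁.filter (fun k => k i = 0), k i = 0 := fun k hk =>
    (Finset.mem_filter.1 hk).2
  rw [← sumG_filter_add Δ₀ i (b + Pi.single i 1), sumG_glue,
    sumG_eq_zero_of_right h0 (by simp),
    Finset.sum_congr rfl (fun k hk => boxG_add_of_eq (b := b) (h0' k hk)),
    Finset.sum_congr rfl (fun k hk => boxG_add_of_ne (b := b) (Finset.mem_filter.1 hk).2),
    Finset.sum_add_distrib, Finset.sum_add_distrib]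
  split_ifs with hb
  · have h1 : ∀ k : Fin v → ℕ, boxG (k + Pi.single i 1) b = 0 := fun k =>
      boxG_eq_zero_of_left (i := i) (by simp) hb
    rw [← sumG_filter_add Δ₁ i b, sumG_eq_zero_of_left (Δ := Δ₁.filter fun k => ¬ k i = 0) (i := i)
      (fun k hk => (Finset.mem_filter.1 hk).2) hb]
    simp only [h1, Finset.sum_const_zero, sumG]
    ring
  · rw [sumG_glue, sumG_eq_zero_of_right h0 hb]
    have : ∑ k ∈ Δ₁.filter (fun k => k i = 0), boxG k b = 0 := sumG_eq_zero_of_right h0' hb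
    rw [this]
    simp only [sumG]
    ring

lemma sumG_insert {Δ : Finset (Fin v → ℕ)} {k : Fin v → ℕ} (h : k ∉ Δ) (a : Fin v → ℕ) :
    sumG (insert k Δ) a = boxG k a + sumG Δ a :=
  Finset.sum_insert h

lemma boxG_le_sumG {Δ : Finset (Fin v → ℕ)} {k : Fin v → ℕ} (h : k ∈ Δ) (a : Fin v → ℕ) :
    boxG k a ≤ sumG Δ a :=
  Finset.single_le_sum (f := fun k => boxG k a) (fun _ _ => Nat.zero_le _) h

end Numeric

section Vanishing

variable {K : Type} [Field K] {v : ℕ} {σ : Type}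

/-- The ideal generated by the variables of row `i`. -/
def rowIdeal (K : Type) [Field K] (r : σ → Fin v) (i : Fin v) : Ideal (MvPolynomial σ K) :=
  Ideal.span {f | ∃ s, r s = i ∧ f = X s}

lemma rowIdeal_le {r : σ → Fin v} {i : Fin v} {I : Ideal (MvPolynomial σ K)} :
    rowIdeal K r i ≤ I ↔ ∀ s, r s = i → X s ∈ I := by
  rw [rowIdeal, Ideal.span_le]
  constructor
  · intro h s hs
    exact h ⟨s, hs, rfl⟩
  · rintro h _ ⟨s, hs, rfl⟩
    exact h s hs

lemma X_mem_homSub_of_eq {r : σ → Fin v} {i : Fin v} {s : σ} (h : r s = i) :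
    (X s : MvPolynomial σ K) ∈ homSub K r (Pi.single i 1) := by
  subst h
  exact X_mem_homSub r s

/-- `Van r I k`: all sufficiently general sections by `k i - 1` forms in the rows `i` of the
support of `k` have empty multiprojective locus (over the rows of that support). -/
inductive Van (r : σ → Fin v) : Ideal (MvPolynomial σ K) → (Fin v → ℕ) → Prop
  | base (I : Ideal (MvPolynomial σ K)) (k : Fin v → ℕ)
      (h : ∀ P : Ideal (MvPolynomial σ K), P.IsPrime → I ≤ P →
        ∃ i, k i ≠ 0 ∧ rowIdeal K r i ≤ P) : Van r I k
  | step (I : Ideal (MvPolynomial σ K)) (k : Fin v → ℕ) (i : Fin v) (l : MvPolynomial σ K)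
      (hl : l ∈ homSub K r (Pi.single i 1)) (hk : 1 ≤ k i) (h : Van r (I ⊔ Ideal.span {l}) k) :
      Van r I (k + Pi.single i 1)

variable {r : σ → Fin v}

lemma Van.of_le_radical {Q I : Ideal (MvPolynomial σ K)} {k : Fin v → ℕ} (h : Van r Q k)
    (hQ : Q ≤ I.radical) : Van r I k := by
  induction h generalizing I with
  | base Q k h =>
    exact Van.base _ _ fun P hP hIP => h P hP (hQ.trans (hP.radical_le_iff.2 hIP))
  | step Q k i l hl hk _ ih =>
    refine Van.step _ _ _ l hl hk (ih (sup_le (hQ.trans (Ideal.radical_mono le_sup_left)) ?_))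
    exact le_sup_right.trans Ideal.le_radical

lemma Van.mono_right {I : Ideal (MvPolynomial σ K)} {k k' : Fin v → ℕ} (h : Van r I k)
    (hk : k ≤ k') : Van r I k' := by
  induction h generalizing k' with
  | base I k h =>
    refine Van.base _ _ fun P hP hIP => ?_
    obtain ⟨i, hi, hle⟩ := h P hP hIP
    exact ⟨i, fun h0 => hi (Nat.le_zero.1 (h0 ▸ hk i)), hle⟩
  | step I k i l hl hki _ ih =>
    have h1 : k i + 1 ≤ k' i := by simpa using hk i
    rw [← sub_add_single (k := k') (i := i) (by omega)]
    have h2 : k ≤ k' - Pi.single i 1 := le_tsub_of_add_le_right hk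
    exact Van.step _ _ _ l hl (hki.trans (h2 i)) (ih h2)

lemma Van.of_pow_mul_le {Q I : Ideal (MvPolynomial σ K)} {k : Fin v → ℕ} (h : Van r Q k)
    {i : Fin v} {D : ℕ} (hQ : rowIdeal K r i ^ D * Q ≤ I) :
    Van r I (Function.update k i (max 1 (k i))) := by
  induction h generalizing I with
  | base Q k h =>
    refine Van.base _ _ fun P hP hIP => ?_
    rcases hP.mul_le.1 (hQ.trans hIP) with h1 | h1
    · exact ⟨i, by simp, hP.le_of_pow_le h1⟩
    · obtain ⟨j, hj, hle⟩ := h P hP h1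
      refine ⟨j, ?_, hle⟩
      by_cases hji : j = i
      · subst hji; simp
      · simpa [hji] using hj
  | step Q k j l hl hk _ ih =>
    have h1 : rowIdeal K r i ^ D * (Q ⊔ Ideal.span {l}) ≤ I ⊔ Ideal.span {l} := by
      rw [Ideal.mul_sup]
      exact sup_le_sup hQ Ideal.mul_le_right
    have h2 := Van.step _ _ j l hl (by
      by_cases hji : j = i
      · subst hji; simp
      · simpa [hji] using hk) (ih h1)
    convert h2 using 1
    ext m
    by_cases hm : m = i
    · subst hm
      by_cases hj : m = j
      · subst hj; simp; omega
      · simp [hj]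
    · simp [hm]

lemma Van.of_pow_mul_le_of_pos {Q I : Ideal (MvPolynomial σ K)} {k : Fin v → ℕ}
    (h : Van r Q k) {i : Fin v} {D : ℕ} (hQ : rowIdeal K r i ^ D * Q ≤ I) (hk : 1 ≤ k i) :
    Van r I k := by
  have := h.of_pow_mul_le hQ
  rwa [max_eq_right hk, Function.update_eq_self] at this

lemma Van.of_pow_mul_le_of_zero {Q I : Ideal (MvPolynomial σ K)} {k : Fin v → ℕ}
    (h : Van r Q k) {i : Fin v} {D : ℕ} (hQ : rowIdeal K r i ^ D * Q ≤ I) (hk : k i = 0) :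
    Van r I (k + Pi.single i 1) := by
  convert h.of_pow_mul_le hQ using 1
  ext m
  by_cases hm : m = i
  · subst hm; simp [hk]
  · simp [hm]

lemma Van.of_rowIdeal_le {I : Ideal (MvPolynomial σ K)} {k : Fin v → ℕ} {i : Fin v}
    (h : rowIdeal K r i ≤ I) (hk : 1 ≤ k i) : Van r I k :=
  Van.base _ _ fun _ _ hIP => ⟨i, by omega, h.trans hIP⟩

lemma Van.of_card_lt {I : Ideal (MvPolynomial σ K)} {k : Fin v → ℕ} {i : Fin v}
    (T : Finset σ) (hT : ∀ s ∈ T, r s = i)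
    (h : rowIdeal K r i ≤ I ⊔ Ideal.span (X '' (T : Set σ))) (hk : T.card + 1 ≤ k i) :
    Van r I k := by
  classical
  induction T using Finset.induction_on generalizing I k with
  | empty =>
    refine Van.of_rowIdeal_le (i := i) ?_ (by omega)
    simpa using h
  | insert s T hs ih =>
    rw [Finset.card_insert_of_notMem hs] at hk
    have h1 : 1 ≤ k i := by omega
    rw [← sub_add_single h1]
    refine Van.step _ _ _ (X s) (X_mem_homSub_of_eq (hT s (by simp))) ?_ ?_
    · simp; omega
    · refine ih (fun t ht => hT t (by simp [ht])) ?_ ?_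
      · rw [Finset.coe_insert, Set.image_insert_eq, Ideal.span_insert, ← sup_assoc] at h
        exact h
      · simp; omega

lemma van_zero_of_top : Van r (⊤ : Ideal (MvPolynomial σ K)) 0 :=
  Van.base _ _ fun _ hP hIP => absurd (top_le_iff.1 hIP) hP.ne_top

/-- Generic forms are nonzerodivisors up to irrelevant torsion. -/
lemma exists_avoid_colon [Finite σ] (r : σ → Fin v) (I : Ideal (MvPolynomial σ K))
    (i : Fin v) : ∃ Ps : Finset (Ideal (MvPolynomial σ K)),
      (∀ p ∈ Ps, ¬ rowIdeal K r i ≤ p) ∧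
      ∀ z, (∀ p ∈ Ps, z ∉ p) → ∃ D, rowIdeal K r i ^ D * colon I z ≤ I := by
  classical
  obtain ⟨t, ht, hprim⟩ := Submodule.isLasker (MvPolynomial σ K) (MvPolynomial σ K) I
  refine ⟨(t.image Ideal.radical).filter fun p => ¬ rowIdeal K r i ≤ p,
    fun p hp => (Finset.mem_filter.1 hp).2, fun z hz => ?_⟩
  have h1 : ∀ q ∈ t, ∃ D, rowIdeal K r i ^ D * colon I z ≤ q := by
    intro q hq
    by_cases hle : rowIdeal K r i ≤ Ideal.radical q
    · obtain ⟨D, hD⟩ := Ideal.exists_pow_le_of_le_radical_of_fg hle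
        (IsNoetherian.noetherian _)
      exact ⟨D, Ideal.mul_le_left.trans hD⟩
    · refine ⟨0, Ideal.mul_le_right.trans fun f hf => ?_⟩
      have hz' := hz (Ideal.radical q)
        (Finset.mem_filter.2 ⟨Finset.mem_image_of_mem _ hq, hle⟩)
      have hIq : I ≤ q := by
        rw [← ht]; exact Finset.inf_le hq
      have h2 : f * z ∈ q := by
        rw [mul_comm]; exact hIq hf
      exact ((Ideal.isPrimary_iff.1 (hprim hq)).2 h2).resolve_right hz'
  choose! D hD using h1
  refine ⟨t.sup D, ?_⟩
  conv_rhs => rw [← ht]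
  refine Finset.le_inf fun q hq => le_trans ?_ (hD q hq)
  exact Ideal.mul_mono_left (Ideal.pow_le_pow_right (Finset.le_sup hq))

lemma exists_form_avoid [Infinite K] (r : σ → Fin v) (i : Fin v)
    (Ps : Finset (Ideal (MvPolynomial σ K))) (h : ∀ p ∈ Ps, ¬ rowIdeal K r i ≤ p) :
    ∃ z ∈ homSub K r (Pi.single i 1), ∀ p ∈ Ps, z ∉ p := by
  classical
  let s : Finset (Subspace K (homSub K r (Pi.single i 1))) :=
    Ps.image fun p => Submodule.comap (Submodule.subtype _) (p.restrictScalars K)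
  have hs : ⊤ ∉ s := by
    intro hmem
    obtain ⟨p, hp, hpt⟩ := Finset.mem_image.1 hmem
    refine h p hp (rowIdeal_le.2 fun t ht => ?_)
    have : (⟨X t, X_mem_homSub_of_eq ht⟩ : homSub K r (Pi.single i 1)) ∈
      (⊤ : Submodule K (homSub K r (Pi.single i 1))) := trivial
    rw [← hpt] at this
    exact this
  have := Subspace.biUnion_ne_univ_of_top_notMem hs
  obtain ⟨z, hz⟩ := (Set.ne_univ_iff_exists_notMem _).1 this
  refine ⟨z, z.2, fun p hp hzp => hz ?_⟩
  simp only [Set.mem_iUnion]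
  exact ⟨_, Finset.mem_image_of_mem _ hp, hzp⟩

end Vanishing

section LowerBound

variable {K : Type} [Field K] {v : ℕ} {σ : Type} {r : σ → Fin v}

lemma sumG_zero_right {Δ : Finset (Fin v → ℕ)} : sumG Δ 0 = if 0 ∈ Δ then 1 else 0 := by
  have h : ∀ k : Fin v → ℕ, k ≠ 0 → boxG k 0 = 0 := fun k hk => by
    by_contra h
    exact hk (boxG_eq_zero_iff.1 h)
  split_ifs with h0
  · rw [sumG, Finset.sum_eq_single_of_mem 0 h0 fun k _ hk => h k hk]
    simp [boxG, rowF]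
  · exact Finset.sum_eq_zero fun k hk => h k fun h1 => h0 (h1 ▸ hk)

lemma one_mem_homSub : (1 : MvPolynomial σ K) ∈ homSub K r 0 := isWeightedHomogeneous_one _ _

/-- The types of nonvanishing sections give a lower bound for the Hilbert function. -/
theorem sumG_le_hf [Infinite K] [Finite σ] {I : Ideal (MvPolynomial σ K)} (hI : MG r I)
    {Δ : Finset (Fin v → ℕ)} (hΔ : ∀ k ∈ Δ, ¬ Van r I k) (a : Fin v → ℕ) :
    sumG Δ a ≤ hf r I a := by
  classical
  induction hN : ∑ i, a i generalizing a I Δ with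
  | zero =>
    have ha : a = 0 := by
      funext i
      exact (Finset.sum_eq_zero_iff.1 hN) i (Finset.mem_univ i)
    subst ha
    rw [sumG_zero_right]
    split_ifs with h0
    · by_contra hlt
      have h1 : hf r I 0 = 0 := by omega
      have h2 := hf_eq_zero_iff.1 h1 1 one_mem_homSub
      exact hΔ 0 h0 ((Ideal.eq_top_iff_one I).2 h2 ▸ van_zero_of_top)
    · exact Nat.zero_le _
  | succ N ihN =>
    obtain ⟨i, -, hi⟩ : ∃ i ∈ Finset.univ, a i ≠ 0 := by
      by_contra! h
      rw [Finset.sum_eq_zero h] at hN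
      omega
    obtain ⟨b, rfl⟩ : ∃ b : Fin v → ℕ, a = b + Pi.single i 1 :=
      ⟨_, (sub_add_single (by omega)).symm⟩
    have hb : ∑ j, b j = N := by
      simp only [Pi.add_apply, Finset.sum_add_distrib, Finset.sum_pi_single',
        Finset.mem_univ, if_true] at hN
      omega
    clear hN hi
    induction I using WellFoundedGT.induction generalizing Δ with
    | ind I ihI =>
    by_cases hrow : rowIdeal K r i ≤ I
    · have : ∀ k ∈ Δ, k i = 0 := fun k hk => by
        by_contra h0
        exact hΔ k hk (Van.of_rowIdeal_le hrow (by omega))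
      rw [sumG_eq_zero_of_right this (by simp)]
      exact Nat.zero_le _
    obtain ⟨Ps, hPs, hcol⟩ := exists_avoid_colon r I i
    obtain ⟨z, hz, hzP⟩ := exists_form_avoid r i (insert I Ps) (by
      intro p hp
      rcases Finset.mem_insert.1 hp with rfl | hp
      · exact hrow
      · exact hPs p hp)
    obtain ⟨D, hD⟩ := hcol z fun p hp => hzP p (Finset.mem_insert_of_mem hp)
    have hzI : z ∉ I := hzP I (Finset.mem_insert_self _ _)
    have hlt : I ⊔ Ideal.span {z} > I := by
      refine lt_of_le_of_ne le_sup_left fun h => hzI ?_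
      rw [h]
      exact Ideal.mem_sup_right (Ideal.mem_span_singleton_self z)
    rw [hf_add hI hz, sumG_split]
    refine add_le_add (ihI _ hlt (hI.sup_span hz) ?_) ?_
    · intro k hk hV
      obtain ⟨h1, h2⟩ := mem_dropTwo.1 hk
      exact hΔ _ h1 (Van.step _ _ _ z hz h2 hV)
    · rw [← sumG_union]
      · refine ihN (hI.colon hz) ?_ b hb
        intro k hk hV
        rcases Finset.mem_union.1 hk with hk | hk
        · obtain ⟨h1, h2⟩ := Finset.mem_filter.1 hk
          exact hΔ _ h1 (hV.of_pow_mul_le_of_pos hD h2)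
        · obtain ⟨h1, h2⟩ := mem_dropOne.1 hk
          exact hΔ _ h1 (hV.of_pow_mul_le_of_zero hD h2)
      · rw [Finset.disjoint_left]
        intro k hk hk'
        have := (Finset.mem_filter.1 hk).2
        have := (mem_dropOne.1 hk').2
        omega

end LowerBound

section UpperBound

lemma finite_not_surjective_pencil {K V W : Type*} [Field K] [AddCommGroup V] [Module K V]
    [AddCommGroup W] [Module K W] [FiniteDimensional K W] (T₀ T₁ : V →ₗ[K] W)
    (h : Function.Surjective T₀) :
    {t : K | ¬ Function.Surjective (T₀ + t • T₁)}.Finite := by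
  obtain ⟨R, hR⟩ := T₀.exists_rightInverse_of_surjective (LinearMap.range_eq_top.2 h)
  let E : Module.End K W := T₁ ∘ₗ R
  have hfin : {μ : K | E.HasEigenvalue μ}.Finite := Module.End.finite_hasEigenvalue E
  refine (hfin.image fun μ => -μ⁻¹).subset ?_
  intro t ht
  rw [Set.mem_ofPred_eq] at ht
  have ht0 : t ≠ 0 := by
    rintro rfl
    exact ht (by simpa using h)
  refine ⟨-t⁻¹, ?_, by simp⟩
  by_contra hev
  have hinj : Function.Injective (LinearMap.id + t • E : W →ₗ[K] W) := by
    rw [injective_iff_map_eq_zero]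
    intro w hw
    by_contra hw0
    refine hev (Module.End.hasEigenvalue_of_hasEigenvector (x := w) ⟨?_, hw0⟩)
    rw [Module.End.mem_eigenspace_iff]
    have h1 : t • E w = -w := by
      rw [eq_neg_iff_add_eq_zero, add_comm]
      simpa using hw
    calc E w = t⁻¹ • (t • E w) := by rw [smul_smul, inv_mul_cancel₀ ht0, one_smul]
      _ = -t⁻¹ • w := by rw [h1, smul_neg, neg_smul]
  have hsurj := LinearMap.injective_iff_surjective.1 hinj
  refine ht fun w => ?_
  obtain ⟨w', hw'⟩ := hsurj w
  refine ⟨R w', ?_⟩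
  have h2 : T₀ (R w') = w' := LinearMap.congr_fun hR w'
  rw [← hw']
  simp [E, h2]

variable {K : Type} [Field K] {v : ℕ} {σ : Type} {r : σ → Fin v}

/-- Multiplication by a form as a map from a graded piece to a quotient of a graded piece. -/
def mulForm (I : Ideal (MvPolynomial σ K)) (e b : Fin v → ℕ) (z : homSub K r e) :
    homSub K r b →ₗ[K] (homSub K r (b + e) ⧸
      Submodule.comap (homSub K r (b + e)).subtype (I.restrictScalars K)) :=
  (Submodule.mkQ _) ∘ₗ ((LinearMap.mulLeft K (z : MvPolynomial σ K)).restrict fun f hf => by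
    rw [add_comm]; exact mul_mem_homSub z.2 hf)

lemma mulForm_apply (I : Ideal (MvPolynomial σ K)) (e b : Fin v → ℕ) (z : homSub K r e)
    (s : homSub K r b) : mulForm I e b z s = Submodule.Quotient.mk
      ⟨(z : MvPolynomial σ K) * s, by rw [add_comm]; exact mul_mem_homSub z.2 s.2⟩ := rfl

lemma mulForm_surjective_iff {I : Ideal (MvPolynomial σ K)} (hI : MG r I) {e b : Fin v → ℕ}
    (z : homSub K r e) : Function.Surjective (mulForm I e b z) ↔
      ∀ f ∈ homSub K r (b + e), f ∈ I ⊔ Ideal.span {(z : MvPolynomial σ K)} := by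
  constructor
  · intro h f hf
    obtain ⟨s, hs⟩ := h (Submodule.Quotient.mk ⟨f, hf⟩)
    rw [mulForm_apply, Submodule.Quotient.eq] at hs
    have h1 : (z : MvPolynomial σ K) * s - f ∈ I := hs
    have h2 : (z : MvPolynomial σ K) * s ∈ Ideal.span {(z : MvPolynomial σ K)} :=
      Ideal.mul_mem_right _ _ (Ideal.mem_span_singleton_self _)
    have := Ideal.sub_mem _ (Ideal.mem_sup_right (S := I) h2) (Ideal.mem_sup_left h1)
    simpa using this
  · intro h q
    obtain ⟨⟨f, hf⟩, rfl⟩ := Submodule.Quotient.mk_surjective _ q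
    obtain ⟨g, hg, s, hs, rfl⟩ := exists_of_mem_sup hI z.2 hf (h f hf)
    refine ⟨⟨s, hs⟩, ?_⟩
    rw [mulForm_apply, Submodule.Quotient.eq]
    change (z : MvPolynomial σ K) * s - (g + z * s) ∈ I
    have := I.neg_mem hg.1
    convert this using 1
    ring

/-- The product of powers of the row ideals. -/
def rowPow (K : Type) [Field K] (r : σ → Fin v) (a : Fin v → ℕ) : Ideal (MvPolynomial σ K) :=
  ∏ j, rowIdeal K r j ^ a j

lemma rowPow_add (a b : Fin v → ℕ) : rowPow K r (a + b) = rowPow K r a * rowPow K r b := by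
  simp only [rowPow, Pi.add_apply, pow_add, Finset.prod_mul_distrib]

lemma monomial_mem_rowPow (d : σ →₀ ℕ) (c : K) :
    monomial d c ∈ rowPow K r (Finsupp.weight (rowWt r) d) := by
  classical
  induction d using Finsupp.induction generalizing c with
  | zero =>
    have : rowPow K r (Finsupp.weight (rowWt r) (0 : σ →₀ ℕ)) = ⊤ := by
      rw [map_zero, ← Ideal.one_eq_top]
      exact Finset.prod_eq_one fun _ _ => pow_zero _
    rw [this]
    trivial
  | single_add s n d _ _ ih =>
    rw [map_add, rowPow_add, ← mul_one c, mul_comm c, ← monomial_mul]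
    refine Ideal.mul_mem_mul ?_ (ih c)
    rw [← X_pow_eq_monomial, rowPow, Finset.prod_eq_single (r s)]
    · have : (Finsupp.weight (rowWt r) (Finsupp.single s n)) (r s) = n := by
        simp [Finsupp.weight_single, rowWt]
      rw [this]
      exact Ideal.pow_mem_pow (rowIdeal_le.1 le_rfl s rfl) n
    · intro j _ hj
      have : (Finsupp.weight (rowWt r) (Finsupp.single s n)) j = 0 := by
        simp [Finsupp.weight_single, rowWt, hj]
      rw [this, pow_zero]
    · simp

lemma homSub_le_rowPow {a : Fin v → ℕ} {f : MvPolynomial σ K} (hf : f ∈ homSub K r a) :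
    f ∈ rowPow K r a := by
  rw [f.as_sum]
  refine Ideal.sum_mem _ fun d hd => ?_
  rw [← hf (mem_support_iff.1 hd)]
  exact monomial_mem_rowPow d _

lemma homSub_le_rowIdeal_pow {a : Fin v → ℕ} {f : MvPolynomial σ K} (hf : f ∈ homSub K r a)
    (i : Fin v) {n : ℕ} (hn : n ≤ a i) : f ∈ rowIdeal K r i ^ n := by
  have h := homSub_le_rowPow hf
  rw [rowPow, ← Finset.mul_prod_erase _ _ (Finset.mem_univ i)] at h
  exact Ideal.pow_le_pow_right hn (Ideal.mul_le_left h)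

/-- The degree which is `N` on the support of `k`. -/
def suppDeg (k : Fin v → ℕ) (N : ℕ) : Fin v → ℕ := fun j => if k j = 0 then 0 else N

lemma exists_homSub_le [Finite σ] {I : Ideal (MvPolynomial σ K)} {k : Fin v → ℕ}
    (h : ∀ P : Ideal (MvPolynomial σ K), P.IsPrime → I ≤ P →
        ∃ i, k i ≠ 0 ∧ rowIdeal K r i ≤ P) :
    ∃ N₀, ∀ N, N₀ ≤ N → ∀ f ∈ homSub K r (suppDeg k N), f ∈ I := by
  classical
  have h1 : ∏ j ∈ Finset.univ.filter (fun j => ¬ k j = 0), rowIdeal K r j ≤ I.radical := by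
    rw [Ideal.radical_eq_sInf]
    refine le_sInf fun P hP => ?_
    obtain ⟨i, hi, hle⟩ := h P hP.2 hP.1
    exact hP.2.prod_le.2 ⟨i, by simpa using hi, hle⟩
  obtain ⟨N₀, hN₀⟩ := Ideal.exists_pow_le_of_le_radical_of_fg h1 (IsNoetherian.noetherian _)
  refine ⟨N₀, fun N hN f hf => hN₀ (Ideal.pow_le_pow_right hN ?_)⟩
  have h2 := homSub_le_rowPow hf
  rw [Finset.prod_filter, ← Finset.prod_pow]
  convert h2 using 2
  refine Finset.prod_congr rfl fun j _ => ?_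
  by_cases hj : k j = 0
  · simp [suppDeg, hj]
  · simp [suppDeg, hj]

lemma van_of_homSub_le {I : Ideal (MvPolynomial σ K)} {k : Fin v → ℕ} {N : ℕ}
    (h : ∀ f ∈ homSub K r (suppDeg k N), f ∈ I) : Van r I k := by
  classical
  refine Van.base _ _ fun P hP hIP => ?_
  by_contra! hcon
  have h1 : ∀ j, ∃ s, k j ≠ 0 → r s = j ∧ (X s : MvPolynomial σ K) ∉ P := by
    intro j
    by_cases hj : k j ≠ 0
    · have := hcon j hj
      rw [rowIdeal_le] at this
      push Not at this
      obtain ⟨s, hs⟩ := this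
      exact ⟨s, fun _ => hs⟩
    · by_cases hne : Nonempty σ
      · exact ⟨hne.some, fun h => absurd h hj⟩
      · exfalso
        have hall : ∀ j, k j = 0 := by
          intro j'
          by_contra hj'
          have := hcon j' hj'
          rw [rowIdeal_le] at this
          push Not at this
          exact hne ⟨this.choose⟩
        have h2 : suppDeg k N = 0 := by
          funext j'; simp [suppDeg, hall]
        exact hP.ne_top ((Ideal.eq_top_iff_one P).2 (hIP (h 1 (h2 ▸ one_mem_homSub))))
  choose s hs using h1
  have h2 : ∏ j ∈ Finset.univ.filter (fun j => k j ≠ 0), (X (s j) : MvPolynomial σ K) ^ N ∈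
      homSub K r (suppDeg k N) := by
    have := IsWeightedHomogeneous.prod (w := rowWt r) (Finset.univ.filter (fun j => k j ≠ 0))
      (fun j => (X (s j) : MvPolynomial σ K) ^ N) (fun j => N • Pi.single j 1) (by
        intro j hj
        refine IsWeightedHomogeneous.pow ?_ N
        exact X_mem_homSub_of_eq (hs j (Finset.mem_filter.1 hj).2).1)
    rw [mem_homSub]
    convert this using 1
    funext j
    rw [Finset.sum_apply, Finset.sum_filter, Finset.sum_eq_single j]
    · simp [suppDeg]
    · intro j' _ hj'
      simp [hj'.symm]
    · simp
  have h3 := hIP (h _ h2)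
  rw [hP.prod_mem_iff] at h3
  obtain ⟨j, hj, hjP⟩ := h3
  exact (hs j (Finset.mem_filter.1 hj).2).2 (hP.mem_of_pow_mem _ hjP)

lemma finite_not_van [Finite σ] {Q : Ideal (MvPolynomial σ K)} {k : Fin v → ℕ}
    (h : Van r Q k) {I : Ideal (MvPolynomial σ K)} (hI : MG r I) {i : Fin v} (hk : k i ≠ 0)
    {l m : MvPolynomial σ K} (hl : l ∈ homSub K r (Pi.single i 1))
    (hm : m ∈ homSub K r (Pi.single i 1)) (hQ : Q = I ⊔ Ideal.span {l}) :
    {t : K | ¬ Van r (I ⊔ Ideal.span {l + t • m}) k}.Finite := by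
  induction h generalizing I with
  | base Q k h =>
    subst hQ
    obtain ⟨N, hN⟩ := exists_homSub_le h
    have hN1 := hN (N + 1) (by omega)
    obtain ⟨b, hb⟩ : ∃ b : Fin v → ℕ, suppDeg k (N + 1) = b + Pi.single i 1 :=
      ⟨_, (sub_add_single (by simp [suppDeg, hk])).symm⟩
    rw [hb] at hN1
    refine (finite_not_surjective_pencil (mulForm I _ b ⟨l, hl⟩) (mulForm I _ b ⟨m, hm⟩)
      ((mulForm_surjective_iff hI ⟨l, hl⟩).2 hN1)).subset ?_
    intro t ht hsurj
    have hlt : l + t • m ∈ homSub K r (Pi.single i 1) :=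
      Submodule.add_mem _ hl (Submodule.smul_mem _ t hm)
    have heq : mulForm I (Pi.single i 1) b (⟨l, hl⟩ : homSub K r _) +
        t • mulForm I (Pi.single i 1) b ⟨m, hm⟩ = mulForm I _ b ⟨l + t • m, hlt⟩ := by
      ext s
      simp only [LinearMap.add_apply, LinearMap.smul_apply, mulForm_apply]
      rw [← Submodule.Quotient.mk_smul, ← Submodule.Quotient.mk_add]
      congr 1
      ext1
      simp [add_mul]
    rw [heq, mulForm_surjective_iff hI, ← hb] at hsurj
    exact ht (van_of_homSub_le hsurj)
  | step Q k j l' hl' hkj _ ih =>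
    subst hQ
    have hki : k i ≠ 0 := by
      by_cases hij : i = j
      · subst hij; omega
      · simpa [hij] using hk
    refine (ih (hI.sup_span hl') hki (by rw [sup_right_comm])).subset ?_
    intro t ht hV
    refine ht (Van.step _ _ j l' hl' hkj ?_)
    rwa [sup_right_comm]

lemma exists_good_section [Infinite K] [Finite σ] {I : Ideal (MvPolynomial σ K)} (hI : MG r I)
    {k : Fin v → ℕ} {i : Fin v} (hk : k i ≠ 0) {l : MvPolynomial σ K}
    (hl : l ∈ homSub K r (Pi.single i 1)) (h : Van r (I ⊔ Ideal.span {l}) k) :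
    ∃ z ∈ homSub K r (Pi.single i 1), Van r (I ⊔ Ideal.span {z}) k ∧
      ∃ D, rowIdeal K r i ^ D * colon I z ≤ I := by
  obtain ⟨Ps, hPs, hcol⟩ := exists_avoid_colon r I i
  obtain ⟨m, hm, hmP⟩ := exists_form_avoid r i Ps hPs
  have h1 := finite_not_van h hI hk hl hm rfl
  have h2 : ∀ p ∈ Ps, {t : K | l + t • m ∈ p}.Finite := by
    intro p hp
    refine Set.Subsingleton.finite fun t ht t' ht' => ?_
    by_contra hne
    have h3 : (l + t • m) - (l + t' • m) ∈ p := p.sub_mem ht ht'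
    have h4 : (t - t') • m ∈ p := by
      convert h3 using 1
      rw [sub_smul]; ring
    have h5 : (t - t')⁻¹ • ((t - t') • m) ∈ p :=
      Submodule.smul_of_tower_mem p _ h4
    rw [smul_smul, inv_mul_cancel₀ (sub_ne_zero.2 hne), one_smul] at h5
    exact hmP p hp h5
  obtain ⟨t, ht⟩ := (h1.union (Ps.finite_toSet.biUnion h2)).exists_notMem
  simp only [Set.mem_union, Set.mem_ofPred_eq, not_or, not_not, Set.mem_iUnion] at ht
  refine ⟨l + t • m, Submodule.add_mem _ hl (Submodule.smul_mem _ t hm), ht.1, hcol _ ?_⟩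
  intro p hp hmem
  exact ht.2 ⟨p, hp, hmem⟩

/-- The upper bound: types that are counted by the Hilbert function do not vanish. -/
theorem not_van_of_hf_eq [Infinite K] [Finite σ] {I : Ideal (MvPolynomial σ K)} (hI : MG r I)
    {Δ : Finset (Fin v → ℕ)} {k : Fin v → ℕ} (hk : k ∈ Δ) (D : ℕ)
    (hD : ∀ a : Fin v → ℕ, (∀ i, k i = 0 → a i = 0) → (∀ i, k i ≠ 0 → D ≤ a i) →
      hf r I a = sumG Δ a) : ¬ Van r I k := by
  classical
  intro hV
  induction hN : ∑ i, k i using Nat.strong_induction_on generalizing I Δ k D with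
  | _ N ih =>
  cases hV with
  | base _ _ h =>
    obtain ⟨N₀, hN₀⟩ := exists_homSub_le h
    have h0 := hf_eq_zero_iff.2 (hN₀ (N₀ + D + 1) (by omega))
    rw [hD] at h0
    · have h1 := boxG_le_sumG hk (suppDeg k (N₀ + D + 1))
      have h2 : 0 < boxG k (suppDeg k (N₀ + D + 1)) := boxG_pos fun i => by
        by_cases hi : k i = 0 <;> simp [suppDeg, hi]
      omega
    · intro i hi; simp [suppDeg, hi]
    · intro i hi; simp [suppDeg, hi]; omega
  | step _ k i l hl hki h =>
    obtain ⟨z, hz, hzV, D', hD'⟩ := exists_good_section hI (by omega : k i ≠ 0) hl h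
    obtain ⟨c, hc⟩ := Ideal.exists_pow_inf_eq_pow_smul (rowIdeal K r i) (colon I z)
    have hcolon : ∀ b : Fin v → ℕ, c + D' ≤ b i → hf r (colon I z) b = hf r I b := by
      intro b hb
      refine hf_congr (le_antisymm ?_ (hPart_mono (le_colon I z) b))
      rintro f ⟨hf1, hf2⟩
      refine ⟨hD' ?_, hf2⟩
      have h1 := hc (c + D') (by omega)
      rw [Nat.add_sub_cancel_left] at h1
      have h2 : f ∈ rowIdeal K r i ^ (c + D') • (⊤ : Submodule (MvPolynomial σ K)
          (MvPolynomial σ K)) ⊓ colon I z := by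
        refine ⟨?_, hf1⟩
        have := homSub_le_rowIdeal_pow hf2 i hb
        simpa using this
      rw [h1] at h2
      exact Submodule.smul_mono le_rfl inf_le_right h2
    refine ih (∑ i, k i) ?_ (hI.sup_span hz) (Δ := dropTwo i Δ) (mem_dropTwo.2 ⟨hk, hki⟩)
      (D + c + D' + 2) ?_ hzV rfl
    · rw [← hN]
      simp [Finset.sum_add_distrib]
    · intro a ha0 ha1
      have hai := ha1 i (by omega)
      obtain ⟨b, rfl⟩ : ∃ b : Fin v → ℕ, a = b + Pi.single i 1 :=
        ⟨_, (sub_add_single (by omega)).symm⟩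
      have hbi : D + c + D' + 1 ≤ b i := by simp at hai; omega
      have hbj : ∀ j, j ≠ i → (b + Pi.single i 1 : Fin v → ℕ) j = b j := fun j hj => by simp [hj]
      have hkj : ∀ j, j ≠ i → (k + Pi.single i 1 : Fin v → ℕ) j = k j := fun j hj => by simp [hj]
      have e1 := hf_add hI hz b
      rw [hcolon b (by omega), hD (b + Pi.single i 1), hD b, sumG_split,
        sumG_eq_zero_of_right (Δ := dropOne i Δ) (i := i) (fun k hk => (mem_dropOne.1 hk).2)
          (by omega)] at e1
      · have e2 := sumG_filter_add Δ i b
        rw [sumG_eq_zero_of_right (i := i) (fun k hk => (Finset.mem_filter.1 hk).2)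
          (by omega)] at e2
        have e3 : Δ.filter (fun k => 1 ≤ k i) = Δ.filter (fun k => ¬ k i = 0) :=
          Finset.filter_congr fun k _ => by omega
        rw [e3] at e1
        omega
      · intro j hj
        by_cases hji : j = i
        · subst hji; simp at hj
        · rw [hkj j hji] at hj
          have := ha0 j hj
          rwa [hbj j hji] at this
      · intro j hj
        by_cases hji : j = i
        · subst hji; omega
        · rw [hkj j hji] at hj
          have := ha1 j hj
          rw [hbj j hji] at this
          omega
      · intro j hj
        by_cases hji : j = i
        · subst hji; simp at hj
        · rw [hkj j hji] at hj
          exact ha0 j hj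
      · intro j hj
        by_cases hji : j = i
        · subst hji; simp; omega
        · rw [hkj j hji] at hj
          have := ha1 j hj
          omega

end UpperBound

section Types

variable {K : Type} [Field K] {v : ℕ} {σ : Type} {r : σ → Fin v}

/-- The types counted by the Hilbert function are exactly the nonvanishing ones. -/
theorem mem_iff_not_van [Infinite K] [Finite σ] {I : Ideal (MvPolynomial σ K)} (hI : MG r I)
    {Δ : Finset (Fin v → ℕ)} (h : ∀ a, hf r I a = sumG Δ a) (k : Fin v → ℕ) :
    k ∈ Δ ↔ ¬ Van r I k := by
  classical
  refine ⟨fun hk => not_van_of_hf_eq hI hk 0 fun a _ _ => h a, fun hk => ?_⟩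
  by_contra hkΔ
  have h1 := sumG_le_hf hI (Δ := insert k Δ) (by
    intro k' hk'
    rcases Finset.mem_insert.1 hk' with rfl | hk'
    · exact hk
    · exact not_van_of_hf_eq hI hk' 0 fun a _ _ => h a) k
  rw [sumG_insert hkΔ, h] at h1
  have h2 : 0 < boxG k k := boxG_pos fun _ => Iff.rfl
  omega

/-- The Hilbert function is a sum of the functions `boxG`. -/
def HasTypes (r : σ → Fin v) (I : Ideal (MvPolynomial σ K)) : Prop :=
  ∃ Δ : Finset (Fin v → ℕ), ∀ a, hf r I a = sumG Δ a

lemma HasTypes.hom_radical [Infinite K] [Finite σ] {I : Ideal (MvPolynomial σ K)}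
    (h : HasTypes r I) (hI : MG r I) {f : MvPolynomial σ K} {e : Fin v → ℕ}
    (hfe : f ∈ homSub K r e) {N : ℕ} (hN : f ^ N ∈ I) : f ∈ I := by
  obtain ⟨Δ, hΔ⟩ := h
  have h1 : I ⊔ Ideal.span {f} ≤ I.radical :=
    sup_le Ideal.le_radical ((Ideal.span_singleton_le_iff_mem _).2 ⟨N, hN⟩)
  have h2 := sumG_le_hf (hI.sup_span hfe) (Δ := Δ) (fun k hk hV =>
    (mem_iff_not_van hI hΔ k).1 hk (hV.of_le_radical h1)) e
  rw [← hΔ] at h2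
  have h3 := hPart_eq_of_hf_le (r := r) (le_sup_left : I ≤ I ⊔ Ideal.span {f}) h2
  have h4 : f ∈ hPart r (I ⊔ Ideal.span {f}) e :=
    ⟨Ideal.mem_sup_right (Ideal.mem_span_singleton_self f), hfe⟩
  rw [← h3] at h4
  exact h4.1

lemma hf_eq_finrank_quotient [Finite σ] (r : σ → Fin v) (I : Ideal (MvPolynomial σ K))
    (a : Fin v → ℕ) : hf r I a = Module.finrank K (homSub K r a ⧸
      Submodule.comap (homSub K r a).subtype (I.restrictScalars K)) := by
  have h1 := Submodule.finrank_quotient_add_finrank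
    (Submodule.comap (homSub K r a).subtype (I.restrictScalars K))
  have h2 : Module.finrank K (hPart r I a) =
      Module.finrank K (Submodule.comap (homSub K r a).subtype (I.restrictScalars K)) := by
    rw [← Submodule.finrank_map_subtype_eq, Submodule.map_comap_subtype, inf_comm]
  rw [hf, h2]
  omega

section Pullback

variable {σ' : Type} {r' : σ' → Fin v} (θ : MvPolynomial σ' K →ₐ[K] MvPolynomial σ K)

/-- An algebra map sending variables to linear forms of the same row. -/
def GradedHom (r' : σ' → Fin v) (r : σ → Fin v)
    (θ : MvPolynomial σ' K →ₐ[K] MvPolynomial σ K) : Prop :=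
  ∀ s, θ (X s) ∈ homSub K r (Pi.single (r' s) 1)

variable {θ}

lemma GradedHom.map_monomial (hθ : GradedHom r' r θ) (d : σ' →₀ ℕ) (c : K) :
    θ (monomial d c) ∈ homSub K r (Finsupp.weight (rowWt r') d) := by
  classical
  induction d using Finsupp.induction generalizing c with
  | zero =>
    have : θ (monomial 0 c) = C c := by
      rw [← C_apply]; exact θ.commutes c
    rw [this, map_zero]
    exact isWeightedHomogeneous_C _ _
  | single_add s n d _ _ ih =>
    rw [map_add, ← mul_one c, mul_comm c, ← monomial_mul, map_mul, ← X_pow_eq_monomial, map_pow]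
    refine mul_mem_homSub ?_ (ih c)
    rw [Finsupp.weight_single]
    exact IsWeightedHomogeneous.pow (hθ s) n

lemma GradedHom.map_mem (hθ : GradedHom r' r θ) {f : MvPolynomial σ' K} {a : Fin v → ℕ}
    (hf : f ∈ homSub K r' a) : θ f ∈ homSub K r a := by
  rw [f.as_sum, map_sum]
  refine Submodule.sum_mem _ fun d hd => ?_
  rw [← hf (mem_support_iff.1 hd)]
  exact hθ.map_monomial d _

lemma GradedHom.component (hθ : GradedHom r' r θ) (f : MvPolynomial σ' K) (a : Fin v → ℕ) :
    weightedHomogeneousComponent (rowWt r) a (θ f) =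
      θ (weightedHomogeneousComponent (rowWt r') a f) := by
  classical
  induction f using MvPolynomial.induction_on' with
  | monomial d c =>
    have h1 := hθ.map_monomial d c
    have h2 := isWeightedHomogeneous_monomial (rowWt r') d c rfl
    rw [weightedHomogeneousComponent_of_mem h1, weightedHomogeneousComponent_of_mem h2]
    split_ifs <;> simp
  | add p q hp hq => simp only [map_add, hp, hq]

lemma GradedHom.MG_comap (hθ : GradedHom r' r θ) {I : Ideal (MvPolynomial σ K)}
    (hI : MG r I) : MG r' (I.comap θ) := by
  intro f hf a
  rw [Ideal.mem_comap, ← hθ.component]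
  exact hI _ hf a

lemma GradedHom.hf_comap [Finite σ] [Finite σ'] (hθ : GradedHom r' r θ)
    (hs : Function.Surjective θ) (I : Ideal (MvPolynomial σ K)) (a : Fin v → ℕ) :
    hf r' (I.comap θ) a = hf r I a := by
  let T : homSub K r' a →ₗ[K] homSub K r a ⧸
      Submodule.comap (homSub K r a).subtype (I.restrictScalars K) :=
    (Submodule.mkQ _) ∘ₗ (θ.toLinearMap.restrict fun f hf => hθ.map_mem hf)
  have hT : Function.Surjective T := by
    refine (Submodule.mkQ_surjective _).comp ?_
    rintro ⟨f, hf⟩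
    obtain ⟨g, rfl⟩ := hs f
    refine ⟨⟨_, weightedHomogeneousComponent_mem (rowWt r') g a⟩, ?_⟩
    ext1
    change θ (weightedHomogeneousComponent (rowWt r') a g) = θ g
    rw [← hθ.component]
    exact IsWeightedHomogeneous.weightedHomogeneousComponent_same hf
  have hker : LinearMap.ker T =
      Submodule.comap (homSub K r' a).subtype ((I.comap θ).restrictScalars K) := by
    ext ⟨f, hf⟩
    rw [LinearMap.mem_ker]
    change Submodule.Quotient.mk _ = 0 ↔ _
    rw [Submodule.Quotient.mk_eq_zero]
    exact Iff.rfl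
  rw [hf_eq_finrank_quotient, hf_eq_finrank_quotient, ← hker]
  exact (T.quotKerEquivOfSurjective hT).finrank_eq

end Pullback

end Types

section Assemble

variable {K : Type} [Field K] {v : ℕ} {σ : Type} {r : σ → Fin v}

/-- The row map on the variables enlarged by one new variable in row `i`. -/
def optRow (i : Fin v) (r : σ → Fin v) : Option σ → Fin v := fun o => o.elim i r

/-- The coefficient of the `j`-th power of the new variable. -/
def xcoeff (j : ℕ) : MvPolynomial (Option σ) K →ₗ[K] MvPolynomial σ K where
  toFun p := (optionEquivLeft K σ p).coeff j
  map_add' p q := by simp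
  map_smul' c p := by simp

lemma xcoeff_def (j : ℕ) (p : MvPolynomial (Option σ) K) :
    xcoeff j p = (optionEquivLeft K σ p).coeff j := rfl

lemma coeff_xcoeff (j : ℕ) (p : MvPolynomial (Option σ) K) (d : σ →₀ ℕ) :
    coeff d (xcoeff j p) = coeff (d.optionElim j) p := optionEquivLeft_coeff_coeff _ _ _ _

lemma optionEquivLeft_rename_some (p : MvPolynomial σ K) :
    optionEquivLeft K σ (rename some p) = Polynomial.C p := by
  induction p using MvPolynomial.induction_on with
  | C c => simp
  | add p q hp hq => simp [hp, hq]
  | mul_X p s hp => simp [hp]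

lemma xcoeff_rename_mul (j : ℕ) (z : MvPolynomial σ K) (p : MvPolynomial (Option σ) K) :
    xcoeff j (rename some z * p) = z * xcoeff j p := by
  rw [xcoeff_def, map_mul, optionEquivLeft_rename_some, Polynomial.coeff_C_mul, xcoeff_def]

lemma xcoeff_rename (j : ℕ) (z : MvPolynomial σ K) :
    xcoeff j (rename some z) = if j = 0 then z else 0 := by
  rw [xcoeff_def, optionEquivLeft_rename_some, Polynomial.coeff_C]

lemma xcoeff_rename_mul_pow (j l : ℕ) (z : MvPolynomial σ K) :
    xcoeff j (rename some z * X none ^ l) = if j = l then z else 0 := by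
  rw [xcoeff_def, map_mul, optionEquivLeft_rename_some, map_pow, optionEquivLeft_X_none,
    Polynomial.coeff_C_mul_X_pow]

lemma xcoeff_X_mul_succ (j : ℕ) (p : MvPolynomial (Option σ) K) :
    xcoeff (j + 1) (X none * p) = xcoeff j p := by
  rw [xcoeff_def, map_mul, optionEquivLeft_X_none, Polynomial.coeff_X_mul, xcoeff_def]

lemma xcoeff_X_mul_zero (p : MvPolynomial (Option σ) K) : xcoeff 0 (X none * p) = 0 := by
  rw [xcoeff_def, map_mul, optionEquivLeft_X_none, Polynomial.coeff_X_mul_zero]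

lemma mem_of_xcoeff {J : Ideal (MvPolynomial (Option σ) K)} {p : MvPolynomial (Option σ) K}
    (h : ∀ j, rename some (xcoeff j p) * X none ^ j ∈ J) : p ∈ J := by
  have : p = ∑ j ∈ (optionEquivLeft K σ p).support, rename some (xcoeff j p) * X none ^ j := by
    apply (optionEquivLeft K σ).injective
    rw [map_sum]
    conv_lhs => rw [Polynomial.as_sum_support_C_mul_X_pow (optionEquivLeft K σ p)]
    refine Finset.sum_congr rfl fun j _ => ?_
    rw [map_mul, optionEquivLeft_rename_some, map_pow, optionEquivLeft_X_none, xcoeff_def]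
  rw [this]
  exact Ideal.sum_mem _ fun j _ => h j

/-- The ideal of polynomials in a new variable whose `j`-th coefficient lies in `Q j`. -/
def assemble (Q : ℕ → Ideal (MvPolynomial σ K)) (hQ : Monotone Q) :
    Ideal (MvPolynomial (Option σ) K) where
  carrier := {p | ∀ j, xcoeff j p ∈ Q j}
  add_mem' {p q} hp hq j := by
    rw [map_add]
    exact Ideal.add_mem _ (hp j) (hq j)
  zero_mem' j := by
    rw [map_zero]
    exact Ideal.zero_mem _
  smul_mem' c p hp j := by
    rw [smul_eq_mul, xcoeff_def, map_mul, Polynomial.coeff_mul]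
    refine Ideal.sum_mem _ fun x hx => Ideal.mul_mem_left _ _ ?_
    exact hQ ((Finset.HasAntidiagonal.mem_antidiagonal.1 hx).symm ▸ Nat.le_add_left _ _) (hp x.2)

variable {Q : ℕ → Ideal (MvPolynomial σ K)} {hQ : Monotone Q} {i : Fin v}

lemma mem_assemble {p : MvPolynomial (Option σ) K} :
    p ∈ assemble Q hQ ↔ ∀ j, xcoeff j p ∈ Q j := Iff.rfl

lemma rename_mul_pow_mem_assemble {f : MvPolynomial σ K} {l : ℕ} :
    rename some f * X none ^ l ∈ assemble Q hQ ↔ f ∈ Q l := by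
  rw [mem_assemble]
  refine ⟨fun h => by simpa [xcoeff_rename_mul_pow] using h l, fun h j => ?_⟩
  rw [xcoeff_rename_mul_pow]
  split_ifs with hj
  · rwa [hj]
  · exact Ideal.zero_mem _

lemma weight_optionElim (i : Fin v) (r : σ → Fin v) (j : ℕ) (d : σ →₀ ℕ) :
    Finsupp.weight (rowWt (optRow i r)) (d.optionElim j) =
      Finsupp.weight (rowWt r) d + Pi.single i j := by
  rw [Finsupp.weight_apply, Finsupp.sum_option_index _ _ (by simp) (by simp [add_smul])]
  simp only [Finsupp.optionElim_apply_none, Finsupp.some_optionElim]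
  rw [add_comm, Finsupp.weight_apply]
  congr 1
  rw [rowWt, ← Pi.single_smul, smul_eq_mul, mul_one]
  rfl

lemma xcoeff_component_add (j : ℕ) (p : MvPolynomial (Option σ) K) (b : Fin v → ℕ) :
    xcoeff j (weightedHomogeneousComponent (rowWt (optRow i r)) (b + Pi.single i j) p) =
      weightedHomogeneousComponent (rowWt r) b (xcoeff j p) := by
  classical
  ext d
  rw [coeff_xcoeff, coeff_weightedHomogeneousComponent, coeff_weightedHomogeneousComponent,
    coeff_xcoeff, weight_optionElim]
  simp only [add_left_inj]

lemma xcoeff_component_of_lt {j : ℕ} (p : MvPolynomial (Option σ) K) {a : Fin v → ℕ}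
    (h : a i < j) :
    xcoeff j (weightedHomogeneousComponent (rowWt (optRow i r)) a p) = 0 := by
  classical
  ext d
  rw [coeff_xcoeff, coeff_weightedHomogeneousComponent, weight_optionElim, if_neg, coeff_zero]
  rintro rfl
  simp at h

lemma exists_add_single {a : Fin v → ℕ} {j : ℕ} (h : j ≤ a i) :
    ∃ b : Fin v → ℕ, a = b + Pi.single i j := by
  refine ⟨a - Pi.single i j, funext fun l => ?_⟩
  by_cases hl : l = i
  · subst hl; simp; omega
  · simp [hl]

lemma MG_assemble (h : ∀ j, MG r (Q j)) : MG (optRow i r) (assemble Q hQ) := by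
  intro p hp a j
  rcases le_or_gt j (a i) with hj | hj
  · obtain ⟨b, rfl⟩ := exists_add_single hj
    rw [xcoeff_component_add]
    exact h j _ (hp j) b
  · rw [xcoeff_component_of_lt p hj]
    exact Ideal.zero_mem _

/-- Setting the new variable equal to zero. -/
def evZero (K : Type) [Field K] (σ : Type) : MvPolynomial (Option σ) K →ₐ[K] MvPolynomial σ K :=
  aeval fun o => o.elim 0 X

lemma evZero_apply (p : MvPolynomial (Option σ) K) : evZero K σ p = xcoeff 0 p := by
  induction p using MvPolynomial.induction_on with
  | C c => simp [evZero, xcoeff_def]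
  | add p q hp hq => rw [map_add, map_add, hp, hq]
  | mul_X p s hp =>
    rw [map_mul, hp]
    cases s with
    | none => rw [mul_comm (p) (X none), xcoeff_X_mul_zero]; simp [evZero]
    | some s =>
      rw [mul_comm p, show (X (some s) : MvPolynomial (Option σ) K) = rename some (X s) by simp,
        xcoeff_rename_mul, mul_comm]
      simp [evZero]

lemma evZero_surjective : Function.Surjective (evZero K σ) := fun f =>
  ⟨rename some f, by rw [evZero_apply, xcoeff_rename, if_pos rfl]⟩

lemma gradedHom_evZero : GradedHom (optRow i r) r (evZero K σ) := by
  rintro (_ | s)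
  · simp only [evZero, aeval_X, Option.elim_none]
    exact Submodule.zero_mem _
  · simp only [evZero, aeval_X, Option.elim_some]
    exact X_mem_homSub r s

lemma X_none_mem_homSub :
    (X none : MvPolynomial (Option σ) K) ∈ homSub K (optRow i r) (Pi.single i 1) :=
  X_mem_homSub (optRow i r) none

lemma gradedHom_rename_some :
    GradedHom r (optRow i r) (rename (R := K) (some : σ → Option σ)) := by
  intro s
  rw [rename_X]
  exact X_mem_homSub (optRow i r) (some s)

lemma assemble_sup_span : assemble Q hQ ⊔ Ideal.span {X none} = (Q 0).comap (evZero K σ) := by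
  apply le_antisymm
  · refine sup_le (fun p hp => ?_) ?_
    · rw [Ideal.mem_comap, evZero_apply]
      exact hp 0
    · rw [Ideal.span_singleton_le_iff_mem, Ideal.mem_comap]
      simp [evZero]
  · intro p hp
    rw [Ideal.mem_comap, evZero_apply] at hp
    refine mem_of_xcoeff fun j => ?_
    cases j with
    | zero => exact Ideal.mem_sup_left (rename_mul_pow_mem_assemble.2 hp)
    | succ j =>
      refine Ideal.mem_sup_right (Ideal.mul_mem_left _ _ ?_)
      rw [pow_succ]
      exact Ideal.mul_mem_left _ _ (Ideal.mem_span_singleton_self _)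

lemma monotone_shift (hQ : Monotone Q) : Monotone fun j => Q (j + 1) :=
  fun _ _ h => hQ (Nat.add_le_add_right h 1)

lemma colon_assemble : colon (assemble Q hQ) (X none) =
    assemble (fun j => Q (j + 1)) (monotone_shift hQ) := by
  ext p
  rw [mem_colon, mem_assemble, mem_assemble]
  refine ⟨fun h j => ?_, fun h j => ?_⟩
  · rw [← xcoeff_X_mul_succ]
    exact h (j + 1)
  · cases j with
    | zero => rw [xcoeff_X_mul_zero]; exact Ideal.zero_mem _
    | succ j => rw [xcoeff_X_mul_succ]; exact h j

lemma hf_assemble_of_eq_zero [Finite σ] (h : ∀ j, MG r (Q j)) {a : Fin v → ℕ} (ha : a i = 0) :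
    hf (optRow i r) (assemble Q hQ) a = hf r (Q 0) a := by
  rw [← gradedHom_evZero.hf_comap evZero_surjective (Q 0) a, ← assemble_sup_span (hQ := hQ),
    hf_sup_span_of_eq_zero (MG_assemble h) X_none_mem_homSub ha]

lemma hf_assemble_add [Finite σ] (h : ∀ j, MG r (Q j)) (b : Fin v → ℕ) :
    hf (optRow i r) (assemble Q hQ) (b + Pi.single i 1) = hf r (Q 0) (b + Pi.single i 1) +
      hf (optRow i r) (assemble (fun j => Q (j + 1)) (monotone_shift hQ)) b := by
  rw [← gradedHom_evZero.hf_comap evZero_surjective (Q 0), ← assemble_sup_span (hQ := hQ),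
    ← colon_assemble (hQ := hQ), ← hf_add (MG_assemble h) X_none_mem_homSub]

lemma hf_assemble [Finite σ] (h : ∀ j, MG r (Q j)) (N : ℕ) (b : Fin v → ℕ) (hb : b i = 0) :
    hf (optRow i r) (assemble Q hQ) (b + Pi.single i N) =
      ∑ j ∈ Finset.range (N + 1), hf r (Q j) (b + Pi.single i (N - j)) := by
  induction N generalizing Q with
  | zero => simpa using hf_assemble_of_eq_zero h hb
  | succ N ih =>
    rw [Pi.single_add, ← add_assoc, hf_assemble_add h, ih fun j => h (j + 1),
      Finset.sum_range_succ' _ (N + 1), add_comm, add_assoc]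
    simp only [Nat.add_sub_add_right, Nat.sub_zero, Pi.single_add]

lemma monotone_colon_pow_sup (I : Ideal (MvPolynomial σ K)) (z : MvPolynomial σ K) :
    Monotone fun j : ℕ => colon I (z ^ j) ⊔ Ideal.span {z} := by
  refine monotone_nat_of_le_succ fun j => sup_le_sup_right (fun f hf => ?_) _
  rw [mem_colon] at hf ⊢
  rw [pow_succ', mul_assoc]
  exact Ideal.mul_mem_left _ _ hf

lemma pow_mem_homSub {z : MvPolynomial σ K} {e : Fin v → ℕ} (hz : z ∈ homSub K r e) (j : ℕ) :
    z ^ j ∈ homSub K r (j • e) := IsWeightedHomogeneous.pow hz j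

lemma MG_colon_pow_sup {I : Ideal (MvPolynomial σ K)} (hI : MG r I) {z : MvPolynomial σ K}
    {e : Fin v → ℕ} (hz : z ∈ homSub K r e) (j : ℕ) :
    MG r (colon I (z ^ j) ⊔ Ideal.span {z}) :=
  (hI.colon (pow_mem_homSub hz j)).sup_span hz

/-- Deformation to the normal cone does not change the Hilbert function. -/
lemma hf_assemble_colon [Finite σ] {I : Ideal (MvPolynomial σ K)} (hI : MG r I) {z : MvPolynomial σ K}
    (hz : z ∈ homSub K r (Pi.single i 1)) (a : Fin v → ℕ) :
    hf (optRow i r) (assemble _ (monotone_colon_pow_sup I z)) a = hf r I a := by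
  have h0 : ∀ I : Ideal (MvPolynomial σ K), colon I (z ^ 0) = I := fun I => by ext; simp
  have hs : ∀ (I : Ideal (MvPolynomial σ K)) (j : ℕ),
      colon I (z ^ (j + 1)) = colon (colon I z) (z ^ j) := fun I j => by
    ext f
    rw [mem_colon, mem_colon, mem_colon, pow_succ', mul_assoc]
  have key : ∀ (N : ℕ) (a : Fin v → ℕ), a i = N → ∀ I : Ideal (MvPolynomial σ K), MG r I →
      hf (optRow i r) (assemble _ (monotone_colon_pow_sup I z)) a = hf r I a := by
    intro N
    induction N with
    | zero =>
      intro a ha I hI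
      rw [hf_assemble_of_eq_zero (MG_colon_pow_sup hI hz) ha, h0,
        hf_sup_span_of_eq_zero hI hz ha]
    | succ N ih =>
      intro a ha I hI
      obtain ⟨b, rfl⟩ := exists_add_single (i := i) (a := a) (j := 1) (by omega)
      rw [hf_assemble_add (MG_colon_pow_sup hI hz), h0, hf_add hI hz b,
        ← ih b (by simpa using ha) _ (hI.colon hz)]
      simp only [hs]
  exact key _ a rfl I hI

end Assemble

section Good

variable {K : Type} [Field K] {v : ℕ}

/-- Ideals occurring as levels of assembled ideals with a Hilbert function given by types. -/
inductive Good : ∀ {σ : Type}, (σ → Fin v) → Ideal (MvPolynomial σ K) → Prop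
  | base {σ : Type} {r : σ → Fin v} {I : Ideal (MvPolynomial σ K)} (hI : MG r I)
      (h : HasTypes r I) : Good r I
  | level {σ : Type} {r : σ → Fin v} (i : Fin v) (Q : ℕ → Ideal (MvPolynomial σ K))
      (hQ : Monotone Q) (hMG : ∀ j, MG r (Q j)) (h : Good (optRow i r) (assemble Q hQ)) (j : ℕ) :
      Good r (Q j)

lemma Good.MG {σ : Type} {r : σ → Fin v} {I : Ideal (MvPolynomial σ K)} (h : Good r I) :
    MG r I := by
  cases h with
  | base hI h => exact hI
  | level i Q hQ hMG h j => exact hMG j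

lemma Good.hom_radical [Infinite K] {σ : Type} {r : σ → Fin v} {I : Ideal (MvPolynomial σ K)}
    (h : Good r I) (hσ : Finite σ) {f : MvPolynomial σ K} {e : Fin v → ℕ}
    (hfe : f ∈ homSub K r e) {N : ℕ} (hN : f ^ N ∈ I) : f ∈ I := by
  induction h generalizing e N with
  | base hI h => exact h.hom_radical hI hfe hN
  | @level σ r i Q hQ hMG h j ih =>
    rcases N.eq_zero_or_pos with rfl | hpos
    · rw [pow_zero] at hN
      rw [(Ideal.eq_top_iff_one _).2 hN]
      trivial
    rw [← rename_mul_pow_mem_assemble (hQ := hQ)]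
    refine ih inferInstance
      (mul_mem_homSub (gradedHom_rename_some.map_mem hfe) (pow_mem_homSub X_none_mem_homSub j))
      (N := N) ?_
    rw [mul_pow, ← map_pow, ← pow_mul, rename_mul_pow_mem_assemble]
    exact hQ (Nat.le_mul_of_pos_right j hpos) hN

lemma monotone_colon {σ : Type} {Q : ℕ → Ideal (MvPolynomial σ K)} (hQ : Monotone Q)
    (z : MvPolynomial σ K) : Monotone fun l => colon (Q l) z :=
  fun _ _ h _ hf => hQ h hf

lemma monotone_sup_span {σ : Type} {Q : ℕ → Ideal (MvPolynomial σ K)} (hQ : Monotone Q)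
    (z : MvPolynomial σ K) : Monotone fun l => Q l ⊔ Ideal.span {z} :=
  fun _ _ h => sup_le_sup_right (hQ h) _

lemma assemble_sup_span_rename {σ : Type} {Q : ℕ → Ideal (MvPolynomial σ K)} (hQ : Monotone Q)
    (z : MvPolynomial σ K) : assemble (fun l => Q l ⊔ Ideal.span {z}) (monotone_sup_span hQ z) =
      assemble Q hQ ⊔ Ideal.span {rename some z} := by
  apply le_antisymm
  · intro p hp
    refine mem_of_xcoeff fun j => ?_
    obtain ⟨s, hs⟩ : ∃ s, xcoeff j p - s * z ∈ Q j := by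
      obtain ⟨q, hq, y, hy, hqy⟩ := Submodule.mem_sup.1 (hp j)
      obtain ⟨s, rfl⟩ := Ideal.mem_span_singleton'.1 hy
      exact ⟨s, by rw [← hqy, add_sub_cancel_right]; exact hq⟩
    rw [← sub_add_cancel (xcoeff j p) (s * z), map_add, add_mul]
    refine Ideal.add_mem _ (Ideal.mem_sup_left (rename_mul_pow_mem_assemble.2 hs))
      (Ideal.mem_sup_right ?_)
    rw [map_mul, mul_right_comm]
    exact Ideal.mul_mem_left _ _ (Ideal.mem_span_singleton_self _)
  · refine sup_le (fun p hp j => Ideal.mem_sup_left (hp j)) ?_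
    rw [Ideal.span_singleton_le_iff_mem]
    intro j
    rw [xcoeff_rename]
    split_ifs
    · exact Ideal.mem_sup_right (Ideal.mem_span_singleton_self z)
    · exact Ideal.zero_mem _

lemma assemble_colon_rename {σ : Type} {Q : ℕ → Ideal (MvPolynomial σ K)} (hQ : Monotone Q)
    (z : MvPolynomial σ K) : assemble (fun l => colon (Q l) z) (monotone_colon hQ z) =
      colon (assemble Q hQ) (rename some z) := by
  ext p
  rw [mem_colon, mem_assemble, mem_assemble]
  simp only [mem_colon, xcoeff_rename_mul]

lemma Good.colon_sup {σ : Type} {r : σ → Fin v} {I : Ideal (MvPolynomial σ K)}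
    (h : Good r I) (hσ : Finite σ) {z : MvPolynomial σ K} {i : Fin v}
    (hz : z ∈ homSub K r (Pi.single i 1)) (j : ℕ) :
    Good r (colon I (z ^ j) ⊔ Ideal.span {z}) := by
  induction h generalizing j with
  | base hI h =>
    refine Good.level i _ (monotone_colon_pow_sup _ z) (MG_colon_pow_sup hI hz) (Good.base ?_ ?_) j
    · exact MG_assemble (MG_colon_pow_sup hI hz)
    · obtain ⟨Δ, hΔ⟩ := h
      exact ⟨Δ, fun a => by rw [hf_assemble_colon hI hz, hΔ]⟩
  | @level σ r i' Q hQ hMG h l ih =>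
    have h1 := ih inferInstance (gradedHom_rename_some.map_mem hz) j
    rw [← map_pow, ← assemble_colon_rename, ← assemble_sup_span_rename] at h1
    exact Good.level i' (fun l => colon (Q l) (z ^ j) ⊔ Ideal.span {z}) _
      (fun l => MG_colon_pow_sup (hMG l) hz j) h1 l

end Good

section Types

variable {K : Type} [Field K] {v : ℕ} {σ : Type} {r : σ → Fin v}

lemma eq_C_of_mem_homSub_zero {f : MvPolynomial σ K} (hf : f ∈ homSub K r 0) :
    f = C (coeff 0 f) := by
  classical
  ext d
  rw [coeff_C]
  split_ifs with h
  · rw [h]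
  · by_contra hd
    have hw := hf hd
    obtain ⟨s, hs⟩ : ∃ s, d s ≠ 0 := by
      by_contra! h'
      exact h (Finsupp.ext fun s => (h' s).symm)
    have h1 : rowWt r s ≤ Finsupp.weight (rowWt r) d := Finsupp.le_weight_of_ne_zero' _ hs
    rw [hw] at h1
    have := h1 (r s)
    simp [rowWt] at this

lemma finrank_homSub_zero : Module.finrank K (homSub K r 0) = 1 := by
  have : homSub K r 0 = Submodule.span K {1} := by
    apply le_antisymm
    · intro f hf
      rw [eq_C_of_mem_homSub_zero hf]
      exact Submodule.mem_span_singleton.2 ⟨coeff 0 f, by rw [smul_eq_C_mul, mul_one]⟩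
    · rw [Submodule.span_singleton_le_iff_mem]
      exact one_mem_homSub
  rw [this, finrank_span_singleton one_ne_zero]

lemma hasTypes_of_rowIdeal_le [Finite σ] {I : Ideal (MvPolynomial σ K)}
    (h : ∀ i, rowIdeal K r i ≤ I) : HasTypes r I := by
  classical
  have h1 : ∀ a : Fin v → ℕ, a ≠ 0 → hf r I a = 0 := fun a ha => by
    obtain ⟨i, hi⟩ := Function.ne_iff.1 ha
    rw [hf_eq_zero_iff]
    intro f hf
    have := homSub_le_rowIdeal_pow hf i (n := 1) (Nat.one_le_iff_ne_zero.2 hi)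
    rw [pow_one] at this
    exact h i this
  by_cases hI : (1 : MvPolynomial σ K) ∈ I
  · refine ⟨∅, fun a => ?_⟩
    rw [sumG, Finset.sum_empty, hf_eq_zero_iff]
    intro f _
    rw [(Ideal.eq_top_iff_one I).2 hI]
    trivial
  · refine ⟨{0}, fun a => ?_⟩
    by_cases ha : a = 0
    · subst ha
      have : hPart r I 0 = ⊥ := by
        rw [eq_bot_iff]
        rintro f ⟨hf1, hf2⟩
        have hc := eq_C_of_mem_homSub_zero hf2
        by_contra hne
        have hne' : coeff 0 f ≠ 0 := fun h0 => hne (by rw [hc, h0, C_0]; exact Submodule.zero_mem _)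
        refine hI ?_
        have h2 : C (coeff 0 f)⁻¹ * f ∈ I := Ideal.mul_mem_left _ _ hf1
        rw [hc, coeff_C, if_pos rfl, ← C_mul, inv_mul_cancel₀ hne', C_1] at h2
        exact h2
      rw [sumG_zero_right, hf, this, finrank_homSub_zero, finrank_bot]
      simp
    · obtain ⟨i, hi⟩ := Function.ne_iff.1 ha
      rw [h1 a ha, sumG_eq_zero_of_right (i := i) (by simp) hi]

theorem Good.hasTypes [Infinite K] [Finite σ] {I : Ideal (MvPolynomial σ K)}
    (h : Good r I) : HasTypes r I := by
  classical
  induction I using WellFoundedGT.induction with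
  | ind I ih =>
  by_cases hrow : ∀ i, rowIdeal K r i ≤ I
  · exact hasTypes_of_rowIdeal_le hrow
  push Not at hrow
  obtain ⟨i, hi⟩ := hrow
  obtain ⟨Ps, hPs, hcol⟩ := exists_avoid_colon r I i
  obtain ⟨z, hz, hzP⟩ := exists_form_avoid r i (insert I Ps) (by
    intro p hp
    rcases Finset.mem_insert.1 hp with rfl | hp
    · exact hi
    · exact hPs p hp)
  obtain ⟨D, hD⟩ := hcol z fun p hp => hzP p (Finset.mem_insert_of_mem hp)
  have hzI : z ∉ I := hzP I (Finset.mem_insert_self _ _)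
  have hlt : I < I ⊔ Ideal.span {z} := by
    refine lt_of_le_of_ne le_sup_left fun he => hzI ?_
    rw [he]
    exact Ideal.mem_sup_right (Ideal.mem_span_singleton_self z)
  have hMG := h.MG
  have hg0 : Good r (I ⊔ Ideal.span {z}) := by
    have := h.colon_sup inferInstance hz 0
    have hc : colon I (z ^ 0) = I := by ext; simp
    rwa [hc] at this
  have hg1 : Good r (colon I z ⊔ Ideal.span {z}) := by
    have := h.colon_sup inferInstance hz 1
    rwa [pow_one] at this
  obtain ⟨Δ₀, h₀⟩ := ih _ hlt hg0
  obtain ⟨Δ₁, h₁⟩ := ih _ (lt_of_lt_of_le hlt (sup_le_sup_right (le_colon I z) _)) hg1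
  have hsame : ∀ b : Fin v → ℕ, b i ≠ 0 → hf r (colon I z) b = hf r I b := by
    intro b hb
    refine hf_congr (le_antisymm ?_ (hPart_mono (le_colon I z) b))
    rintro f ⟨hf1, hf2⟩
    refine ⟨h.hom_radical inferInstance hf2 (N := D + 1) (hD ?_), hf2⟩
    rw [pow_succ]
    refine Ideal.mul_mem_mul (homSub_le_rowIdeal_pow (pow_mem_homSub hf2 D) i ?_) hf1
    rw [Pi.smul_apply, smul_eq_mul]
    exact Nat.le_mul_of_pos_right D (Nat.pos_of_ne_zero hb)
  refine ⟨glue i Δ₀ Δ₁, fun a => ?_⟩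
  obtain ⟨N, hN⟩ : ∃ N, a i = N := ⟨_, rfl⟩
  induction N generalizing a with
  | zero => rw [sumG_glue_zero _ _ _ hN, ← h₀, hf_sup_span_of_eq_zero hMG hz hN]
  | succ N ihN =>
    obtain ⟨b, rfl⟩ := exists_add_single (i := i) (a := a) (j := 1) (by omega)
    rw [hf_add hMG hz, sumG_glue_succ, h₀]
    congr 1
    split_ifs with hb
    · rw [← h₁, hf_sup_span_of_eq_zero (hMG.colon hz) hz hb]
    · rw [hsame b hb, ihN b (by simpa using hN)]

lemma HasTypes.sup_span [Infinite K] [Finite σ] {I : Ideal (MvPolynomial σ K)}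
    (h : HasTypes r I) (hI : MG r I) {z : MvPolynomial σ K} {i : Fin v}
    (hz : z ∈ homSub K r (Pi.single i 1)) : HasTypes r (I ⊔ Ideal.span {z}) := by
  have := (Good.base hI h).colon_sup inferInstance hz 0
  have hc : colon I (z ^ 0) = I := by ext; simp
  rw [hc] at this
  exact this.hasTypes

end Types

section Elimination

variable {K : Type} [Field K] {v : ℕ} {σ : Type} {r : σ → Fin v} {i : Fin v}

/-- The space of polynomials of degree less than `m` in the new variable. -/
def xlt (K : Type) [Field K] (σ : Type) (m : ℕ) : Submodule K (MvPolynomial (Option σ) K) where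
  carrier := {p | ∀ l, m ≤ l → xcoeff l p = 0}
  add_mem' {p q} hp hq l hl := by rw [map_add, hp l hl, hq l hl, add_zero]
  zero_mem' l _ := map_zero _
  smul_mem' c p hp l hl := by rw [map_smul, hp l hl, smul_zero]

lemma mem_xlt {m : ℕ} {p : MvPolynomial (Option σ) K} :
    p ∈ xlt K σ m ↔ ∀ l, m ≤ l → xcoeff l p = 0 := Iff.rfl

lemma xcoeff_ext {p q : MvPolynomial (Option σ) K} (h : ∀ j, xcoeff j p = xcoeff j q) :
    p = q :=
  (optionEquivLeft K σ).injective (Polynomial.ext h)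

/-- The ideal of leading coefficients of elements of degree at most `j` in the new variable. -/
def lc (I : Ideal (MvPolynomial (Option σ) K)) (j : ℕ) : Ideal (MvPolynomial σ K) where
  carrier := {c | ∃ p ∈ I, p ∈ xlt K σ (j + 1) ∧ xcoeff j p = c}
  add_mem' := by
    rintro _ _ ⟨p, hp, hp', rfl⟩ ⟨q, hq, hq', rfl⟩
    exact ⟨p + q, I.add_mem hp hq, Submodule.add_mem _ hp' hq', map_add _ _ _⟩
  zero_mem' := ⟨0, I.zero_mem, Submodule.zero_mem _, map_zero _⟩
  smul_mem' := by
    rintro c _ ⟨p, hp, hp', rfl⟩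
    refine ⟨rename some c * p, I.mul_mem_left _ hp, fun l hl => ?_, xcoeff_rename_mul _ _ _⟩
    rw [xcoeff_rename_mul, hp' l hl, mul_zero]

lemma mem_lc {I : Ideal (MvPolynomial (Option σ) K)} {j : ℕ} {c : MvPolynomial σ K} :
    c ∈ lc I j ↔ ∃ p ∈ I, p ∈ xlt K σ (j + 1) ∧ xcoeff j p = c := Iff.rfl

lemma monotone_lc (I : Ideal (MvPolynomial (Option σ) K)) : Monotone (lc I) := by
  refine monotone_nat_of_le_succ fun j => ?_
  rintro _ ⟨p, hp, hp', rfl⟩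
  refine ⟨X none * p, I.mul_mem_left _ hp, fun l hl => ?_, xcoeff_X_mul_succ _ _⟩
  obtain ⟨l, rfl⟩ : ∃ l', l = l' + 1 := ⟨l - 1, by omega⟩
  rw [xcoeff_X_mul_succ]
  exact hp' l (by omega)

lemma component_mem_xlt {m : ℕ} {p : MvPolynomial (Option σ) K} (hp : p ∈ xlt K σ m)
    (a : Fin v → ℕ) :
    weightedHomogeneousComponent (rowWt (optRow i r)) a p ∈ xlt K σ m := by
  intro l hl
  rcases le_or_gt l (a i) with h | h
  · obtain ⟨b, rfl⟩ := exists_add_single h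
    rw [xcoeff_component_add, hp l hl, map_zero]
  · exact xcoeff_component_of_lt p h

lemma MG_lc {I : Ideal (MvPolynomial (Option σ) K)} (hI : MG (optRow i r) I) (j : ℕ) :
    MG r (lc I j) := by
  intro c hc a
  obtain ⟨p, hp, hp', hpc⟩ := mem_lc.1 hc
  have h := xcoeff_component_add (r := r) (i := i) j p a
  generalize a + Pi.single i j = b at h
  rw [hpc] at h
  exact mem_lc.2 ⟨_, hI p hp b, component_mem_xlt hp' b, h⟩

lemma lc_zero (I : Ideal (MvPolynomial (Option σ) K)) :
    lc I 0 = I.comap (rename (R := K) (some : σ → Option σ)) := by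
  ext c
  rw [Ideal.mem_comap]
  constructor
  · rintro ⟨p, hp, hp', rfl⟩
    convert hp
    refine xcoeff_ext fun j => ?_
    rw [xcoeff_rename]
    split_ifs with h
    · rw [h]
    · exact (hp' j (by omega)).symm
  · intro h
    refine ⟨_, h, fun l hl => ?_, by rw [xcoeff_rename, if_pos rfl]⟩
    rw [xcoeff_rename, if_neg (by omega)]

lemma finrank_map_add_finrank_inf_ker {V W : Type*} [AddCommGroup V] [Module K V]
    [AddCommGroup W] [Module K W] (f : V →ₗ[K] W) (P : Submodule K V) [Module.Finite K P] :
    Module.finrank K (P.map f) + Module.finrank K (P ⊓ LinearMap.ker f : Submodule K V) =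
      Module.finrank K P := by
  rw [← LinearMap.finrank_range_add_finrank_ker (f.domRestrict P), LinearMap.range_domRestrict,
    LinearMap.ker_domRestrict, ← Submodule.finrank_map_subtype_eq, Submodule.map_comap_subtype]

variable [Finite σ]

lemma finrank_hPart_assemble {Q : ℕ → Ideal (MvPolynomial σ K)} {hQ : Monotone Q}
    (h : ∀ j, MG r (Q j)) (N : ℕ) (b : Fin v → ℕ) (hb : b i = 0) :
    Module.finrank K (hPart (optRow i r) (assemble Q hQ) (b + Pi.single i N)) =
      ∑ j ∈ Finset.range (N + 1), Module.finrank K (hPart r (Q j) (b + Pi.single i (N - j))) := by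
  have hbot : ∀ a, hf r (⊥ : Ideal (MvPolynomial σ K)) a = Module.finrank K (homSub K r a) := by
    intro a
    have : hPart r (⊥ : Ideal (MvPolynomial σ K)) a = ⊥ := by
      rw [hPart, Submodule.restrictScalars_bot, bot_inf_eq]
    rw [hf, this, finrank_bot, Nat.sub_zero]
  have hMG : MG r (⊥ : Ideal (MvPolynomial σ K)) := by
    intro f hf a
    rw [Ideal.mem_bot] at hf ⊢
    rw [hf, map_zero]
  have hass : assemble (fun _ : ℕ => (⊥ : Ideal (MvPolynomial σ K))) monotone_const = ⊥ := by
    rw [eq_bot_iff]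
    intro p hp
    exact (Ideal.mem_bot).2 (xcoeff_ext fun j => by rw [map_zero]; exact hp j)
  have h1 := hf_assemble (hQ := monotone_const) (fun _ => hMG) N b hb
  have h2 := hf_assemble (hQ := hQ) h N b hb
  have h3 := finrank_hPart_add_hf (optRow i r) (assemble Q hQ) (b + Pi.single i N)
  have h4 := finrank_hPart_add_hf (optRow i r) (⊥ : Ideal (MvPolynomial (Option σ) K))
    (b + Pi.single i N)
  have h5 : Module.finrank K (hPart (optRow i r) (⊥ : Ideal (MvPolynomial (Option σ) K))
      (b + Pi.single i N)) = 0 := by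
    have : hPart (optRow i r) (⊥ : Ideal (MvPolynomial (Option σ) K)) (b + Pi.single i N) = ⊥ := by
      rw [hPart, Submodule.restrictScalars_bot, bot_inf_eq]
    rw [this, finrank_bot]
  rw [hass] at h1
  simp only [hbot] at h1
  have h6 : ∑ j ∈ Finset.range (N + 1),
      Module.finrank K (hPart r (Q j) (b + Pi.single i (N - j))) +
      ∑ j ∈ Finset.range (N + 1), hf r (Q j) (b + Pi.single i (N - j)) =
      ∑ j ∈ Finset.range (N + 1), Module.finrank K (homSub K r (b + Pi.single i (N - j))) := by
    rw [← Finset.sum_add_distrib]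
    exact Finset.sum_congr rfl fun j _ => finrank_hPart_add_hf r (Q j) _
  omega

lemma finrank_hPart_inf_xlt {I : Ideal (MvPolynomial (Option σ) K)} (hI : MG (optRow i r) I)
    (N : ℕ) (b : Fin v → ℕ) (m : ℕ) (hm : m ≤ N + 1) :
    Module.finrank K (hPart (optRow i r) I (b + Pi.single i N) ⊓ xlt K σ m :
        Submodule K (MvPolynomial (Option σ) K)) =
      ∑ j ∈ Finset.range m, Module.finrank K (hPart r (lc I j) (b + Pi.single i (N - j))) := by
  induction m with
  | zero =>
    have : xlt K σ 0 = ⊥ := by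
      rw [eq_bot_iff]
      intro p hp
      exact (Submodule.mem_bot K).2 (xcoeff_ext fun j => by
        rw [map_zero]; exact hp j (Nat.zero_le _))
    rw [this, inf_bot_eq, finrank_bot, Finset.sum_range_zero]
  | succ m ih =>
    have hsplit : b + Pi.single i N = (b + Pi.single i (N - m)) + Pi.single i m := by
      rw [add_assoc, ← Pi.single_add, Nat.sub_add_cancel (by omega)]
    have hfin : Module.Finite K (hPart (optRow i r) I (b + Pi.single i N) ⊓ xlt K σ (m + 1) :
        Submodule K (MvPolynomial (Option σ) K)) :=
      Submodule.finiteDimensional_of_le inf_le_left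
    have hker : hPart (optRow i r) I (b + Pi.single i N) ⊓ xlt K σ (m + 1) ⊓
        LinearMap.ker (xcoeff m) = hPart (optRow i r) I (b + Pi.single i N) ⊓ xlt K σ m := by
      rw [inf_assoc]
      congr 1
      ext p
      rw [Submodule.mem_inf, LinearMap.mem_ker, mem_xlt, mem_xlt]
      constructor
      · rintro ⟨h2, h3⟩ l hl
        rcases hl.eq_or_lt with h | hl
        · rw [← h]; exact h3
        · exact h2 l hl
      · exact fun h2 => ⟨fun l hl => h2 l (by omega), h2 m le_rfl⟩
    have hmap : (hPart (optRow i r) I (b + Pi.single i N) ⊓ xlt K σ (m + 1)).map (xcoeff m) =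
        hPart r (lc I m) (b + Pi.single i (N - m)) := by
      apply le_antisymm
      · intro c hc
        obtain ⟨p, ⟨⟨h1, h2⟩, h3⟩, hpc⟩ := Submodule.mem_map.1 hc
        have h4 : weightedHomogeneousComponent (rowWt (optRow i r)) (b + Pi.single i N) p = p :=
          IsWeightedHomogeneous.weightedHomogeneousComponent_same h2
        refine ⟨mem_lc.2 ⟨p, h1, h3, hpc⟩, ?_⟩
        rw [← hpc, ← h4, hsplit, xcoeff_component_add]
        exact weightedHomogeneousComponent_mem _ _ _
      · rintro c ⟨hc, h2⟩
        obtain ⟨p, h1, h3, hpc⟩ := mem_lc.1 hc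
        refine Submodule.mem_map.2
          ⟨_, ⟨⟨hI p h1 _, weightedHomogeneousComponent_mem _ _ _⟩, component_mem_xlt h3 _⟩, ?_⟩
        have h := xcoeff_component_add (r := r) (i := i) m p (b + Pi.single i (N - m))
        rw [← hsplit, hpc] at h
        exact h.trans (IsWeightedHomogeneous.weightedHomogeneousComponent_same h2)
    have h := finrank_map_add_finrank_inf_ker (xcoeff m)
      (hPart (optRow i r) I (b + Pi.single i N) ⊓ xlt K σ (m + 1))
    rw [hker, hmap, ih (by omega)] at h
    rw [Finset.sum_range_succ, ← h, add_comm]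

lemma hf_assemble_lc {I : Ideal (MvPolynomial (Option σ) K)} (hI : MG (optRow i r) I)
    (a : Fin v → ℕ) :
    hf (optRow i r) (assemble (lc I) (monotone_lc I)) a = hf (optRow i r) I a := by
  obtain ⟨b, hb⟩ := exists_add_single (i := i) (a := a) (j := a i) le_rfl
  have hbi : b i = 0 := by
    have := congrFun hb i
    simpa using this
  have h1 := finrank_hPart_assemble (hQ := monotone_lc I) (MG_lc hI) (a i) b hbi
  have h2 := finrank_hPart_inf_xlt hI (a i) b (a i + 1) le_rfl
  rw [← hb] at h1 h2
  have h3 : hPart (optRow i r) I a ⊓ xlt K σ (a i + 1) = hPart (optRow i r) I a := by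
    refine inf_eq_left.2 ?_
    rintro p ⟨_, hp⟩ l hl
    have h4 : weightedHomogeneousComponent (rowWt (optRow i r)) a p = p :=
      IsWeightedHomogeneous.weightedHomogeneousComponent_same hp
    rw [← h4]
    exact xcoeff_component_of_lt p (by omega)
  rw [h3] at h2
  rw [hf, hf, h1, h2]

lemma HasTypes.comap_rename_some [Infinite K] {I : Ideal (MvPolynomial (Option σ) K)}
    (hI : MG (optRow i r) I) (h : HasTypes (optRow i r) I) :
    HasTypes r (I.comap (rename (R := K) (some : σ → Option σ))) := by
  rw [← lc_zero]
  refine (Good.level i (lc I) (monotone_lc I) (MG_lc hI) (Good.base ?_ ?_) 0).hasTypes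
  · exact MG_assemble (MG_lc hI)
  · obtain ⟨Δ, hΔ⟩ := h
    exact ⟨Δ, fun a => by rw [hf_assemble_lc hI, hΔ]⟩

end Elimination

section Subring

variable {K : Type} [Field K] {v : ℕ}

lemma gradedHom_rename {σ σ' : Type} (f : σ → σ') (r' : σ' → Fin v) :
    GradedHom (r' ∘ f) r' (rename (R := K) f) := fun s => by
  rw [rename_X]
  exact X_mem_homSub r' (f s)

lemma HasTypes.comap {σ σ' : Type} [Finite σ] [Finite σ'] {r : σ → Fin v} {r' : σ' → Fin v}
    {I : Ideal (MvPolynomial σ K)} (h : HasTypes r I)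
    {θ : MvPolynomial σ' K →ₐ[K] MvPolynomial σ K} (hθ : GradedHom r' r θ)
    (hs : Function.Surjective θ) : HasTypes r' (I.comap θ) := by
  obtain ⟨Δ, hΔ⟩ := h
  exact ⟨Δ, fun a => by rw [hθ.hf_comap hs, hΔ]⟩

lemma HasTypes.comap_rename [Infinite K] {σ : Type} [Finite σ] (N : ℕ) :
    ∀ (σ' : Type) [Finite σ'] (_ : Nat.card σ' = N) (r' : σ' → Fin v) (f : σ → σ')
      (_ : Function.Injective f) (I : Ideal (MvPolynomial σ' K)) (_ : MG r' I)
      (_ : HasTypes r' I), HasTypes (r' ∘ f) (I.comap (rename (R := K) f)) := by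
  classical
  induction N with
  | zero =>
    intro σ' _ hN r' f hf I hI h
    have : IsEmpty σ' := Finite.card_eq_zero_iff.1 hN
    exact h.comap (gradedHom_rename f r') (rename_surjective f fun s => isEmptyElim s)
  | succ N ih =>
    intro σ' _ hN r' f hf I hI h
    by_cases hs : Function.Surjective f
    · exact h.comap (gradedHom_rename f r') (rename_surjective f hs)
    · obtain ⟨s, hs⟩ := not_forall.1 hs
      let e : Option {t // t ≠ s} ≃ σ' := Equiv.optionSubtypeNe s
      have hrow : r' ∘ e = optRow (r' s) (fun t : {t // t ≠ s} => r' t) := by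
        funext o
        cases o <;> simp [e, optRow]
      have hg := gradedHom_rename (K := K) e r'
      have h1 := h.comap hg (rename_surjective e e.surjective)
      have h2 := hg.MG_comap hI
      rw [hrow] at h1 h2
      have h3 := HasTypes.comap_rename_some h2 h1
      have hg3 : GradedHom (fun t : {t // t ≠ s} => r' t) (optRow (r' s) _)
        (rename (R := K) some) := gradedHom_rename_some
      have h4 := hg3.MG_comap h2
      have hcard : Nat.card {t // t ≠ s} = N := by
        have := Nat.card_congr e
        rw [Finite.card_option, hN] at this
        omega
      have h5 := ih {t // t ≠ s} hcard (fun t => r' t)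
        (fun t => ⟨f t, fun ht => hs ⟨t, ht⟩⟩)
        (fun a b hab => hf (congrArg Subtype.val hab)) _ h4 h3
      have heq : I.comap (rename (R := K) f) = (((I.comap (rename (R := K) e)).comap
          (rename (R := K) some)).comap (rename (R := K)
            (fun t => (⟨f t, fun ht => hs ⟨t, ht⟩⟩ : {t // t ≠ s})))) := by
        ext p
        simp only [Ideal.mem_comap, rename_rename]
        rfl
      rw [heq]
      exact h5

theorem HasTypes.comap_graded [Infinite K] {σ τ : Type} [Finite σ] [Finite τ] {r : σ → Fin v}
    {t : τ → Fin v} {I : Ideal (MvPolynomial σ K)} (hI : MG r I) (h : HasTypes r I)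
    {φ : MvPolynomial τ K →ₐ[K] MvPolynomial σ K} (hφ : GradedHom t r φ) :
    HasTypes t (I.comap φ) := by
  let θ : MvPolynomial (τ ⊕ σ) K →ₐ[K] MvPolynomial σ K :=
    aeval (Sum.elim (fun s => φ (X s)) X)
  have hθ : GradedHom (Sum.elim t r) r θ := by
    rintro (s | s)
    · simpa [θ] using hφ s
    · simpa [θ] using X_mem_homSub r s
  have hinr : ∀ p, θ (rename Sum.inr p) = p := fun p => by
    simp only [θ, aeval_rename, Sum.elim_comp_inr]
    exact aeval_X_left_apply p
  have hinl : ∀ p, θ (rename Sum.inl p) = φ p := fun p => by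
    simp only [θ, aeval_rename, Sum.elim_comp_inl]
    exact (DFunLike.congr_fun (aeval_unique φ) p).symm
  have h1 := HasTypes.comap_rename _ (τ ⊕ σ) rfl (Sum.elim t r) Sum.inl Sum.inl_injective _
    (hθ.MG_comap hI) (h.comap hθ fun p => ⟨_, hinr p⟩)
  have heq : I.comap φ = (I.comap θ).comap (rename (R := K) Sum.inl) := by
    ext p
    simp only [Ideal.mem_comap, hinl]
  rw [heq]
  exact h1

end Subring

section Counting

/-- The position from the end of the smallest index in the support of `m` (and `0` for
`m = 0`). -/
def rowKap {N : ℕ} (m : Fin N → ℕ) : ℕ :=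
  Finset.univ.sup fun j => if m j = 0 then 0 else N - (j : ℕ)

lemma rowKap_le_iff {N k : ℕ} {m : Fin N → ℕ} :
    rowKap m ≤ k ↔ ∀ j, m j ≠ 0 → N - (j : ℕ) ≤ k := by
  rw [rowKap, Finset.sup_le_iff]
  refine forall_congr' fun j => ?_
  by_cases h : m j = 0 <;> simp [h]

lemma rowKap_le {N : ℕ} (m : Fin N → ℕ) : rowKap m ≤ N :=
  rowKap_le_iff.2 fun _ _ => Nat.sub_le _ _

lemma rowKap_cons_zero {N : ℕ} (m : Fin N → ℕ) :
    rowKap (Fin.cons 0 m : Fin (N + 1) → ℕ) = rowKap m := by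
  refine eq_of_forall_ge_iff fun k => ?_
  rw [rowKap_le_iff, rowKap_le_iff, Fin.forall_fin_succ]
  simp

lemma rowKap_eq_succ_iff {N : ℕ} (m : Fin (N + 1) → ℕ) : rowKap m = N + 1 ↔ m 0 ≠ 0 := by
  rw [← (rowKap_le m).ge_iff_eq, ← not_lt, Nat.lt_succ_iff, rowKap_le_iff, not_iff_not]
  constructor
  · intro h
    by_contra h0
    have := h 0 h0
    simp at this
  · intro h j hj
    have : (j : ℕ) ≠ 0 := fun h' => hj (by rw [show j = 0 from Fin.ext h']; exact h)
    omega

lemma card_sum_eq (N a : ℕ) :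
    Nat.card {m : Fin N → ℕ // ∑ j, m j = a} = Nat.multichoose N a := by
  rw [← Nat.card_congr (Sym.equivNatSumOfFintype (Fin N) a), Nat.card_eq_fintype_card,
    Sym.card_sym_eq_multichoose, Fintype.card_fin]

lemma card_rowKap (N k a : ℕ) (hk : k ≤ N) :
    Nat.card {m : Fin N → ℕ // ∑ j, m j = a ∧ rowKap m = k} = rowF k a := by
  induction N with
  | zero =>
    obtain rfl : k = 0 := by omega
    have h : ∀ m : Fin 0 → ℕ, rowKap m = 0 := fun m => Nat.le_zero.1 (rowKap_le m)
    simp only [h, and_true, card_sum_eq]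
    cases a <;> simp [rowF]
  | succ N ih =>
    rcases hk.eq_or_lt with rfl | hk
    · simp only [rowKap_eq_succ_iff]
      rcases a with _ | a
      · rw [rowF_zero_right (by omega), Nat.card_eq_zero]
        left
        refine ⟨fun ⟨m, h1, h2⟩ => h2 ?_⟩
        exact (Finset.sum_eq_zero_iff.1 h1) 0 (Finset.mem_univ _)
      · rw [rowF, ← card_sum_eq]
        refine Nat.card_congr ⟨fun m => ⟨m.1 - Pi.single 0 1, ?_⟩,
          fun m => ⟨m.1 + Pi.single 0 1, ?_, by simp⟩, fun m => ?_, fun m => ?_⟩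
        · have h := m.2.1
          have h2 := m.2.2
          rw [Fin.sum_univ_succ] at h ⊢
          simp
          omega
        · simp only [Pi.add_apply, Finset.sum_add_distrib, m.2]
          simp
        · apply Subtype.ext
          have h2 := m.2.2
          funext j
          refine Fin.cases ?_ (fun j => ?_) j
          · simp; omega
          · simp
        · apply Subtype.ext
          funext j
          simp
    · rw [← ih (by omega)]
      have h0 : ∀ m : Fin (N + 1) → ℕ, rowKap m = k → m 0 = 0 := by
        intro m hm
        by_contra h
        have := (rowKap_eq_succ_iff m).2 h
        omega
      refine Nat.card_congr ⟨fun m => ⟨Fin.tail m.1, ?_⟩, fun m => ⟨Fin.cons 0 m.1, ?_⟩,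
        fun m => ?_, fun m => ?_⟩
      · have h := h0 _ m.2.2
        have h1 := m.2.1
        rw [Fin.sum_univ_succ, h, zero_add] at h1
        refine ⟨h1, ?_⟩
        rw [← rowKap_cons_zero, ← h, Fin.cons_self_tail]
        exact m.2.2
      · rw [rowKap_cons_zero, Fin.sum_univ_succ]
        simpa using m.2
      · apply Subtype.ext
        have h := h0 _ m.2.2
        change (Fin.cons 0 (Fin.tail m.1) : Fin (N + 1) → ℕ) = m.1
        rw [← h, Fin.cons_self_tail]
      · apply Subtype.ext
        exact Fin.tail_cons (α := fun _ => ℕ) 0 m.1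

variable {v : ℕ} {n : Fin v → ℕ}

/-- The type of a monomial. -/
def kap (d : MVar v n →₀ ℕ) (i : Fin v) : ℕ := rowKap fun j : Fin (n i + 1) => d ⟨i, j⟩

lemma kap_le_iff {d : MVar v n →₀ ℕ} {k : Fin v → ℕ} :
    kap d ≤ k ↔ ∀ s, d s ≠ 0 → n s.1 + 1 - (s.2 : ℕ) ≤ k s.1 := by
  rw [Pi.le_def, Sigma.forall]
  exact forall_congr' fun i => rowKap_le_iff

lemma kap_le (d : MVar v n →₀ ℕ) : kap d ≤ fun i => n i + 1 := fun _ => rowKap_le _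

lemma weight_eq_iff {d : MVar v n →₀ ℕ} {a : Fin v → ℕ} :
    Finsupp.weight (rowWt (Sigma.fst : MVar v n → Fin v)) d = a ↔
      ∀ i, ∑ j, d ⟨i, j⟩ = a i := by
  rw [funext_iff]
  refine forall_congr' fun i => ?_
  rw [Finsupp.weight_apply, Finsupp.sum_fintype _ _ (by simp), Finset.sum_apply,
    Fintype.sum_sigma, Finset.sum_eq_single i]
  · simp [rowWt]
  · intro b _ hb
    simp [rowWt, hb.symm]
  · simp

lemma card_kap (k a : Fin v → ℕ) (hk : k ≤ fun i => n i + 1) :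
    Nat.card {d : MVar v n →₀ ℕ // Finsupp.weight (rowWt (Sigma.fst : MVar v n → Fin v)) d = a ∧
      kap d = k} = boxG k a := by
  rw [boxG, ← Finset.prod_congr rfl fun i _ => card_rowKap (n i + 1) (k i) (a i) (hk i),
    ← Nat.card_pi]
  refine Nat.card_congr (Equiv.trans ?_ Equiv.subtypePiEquivPi)
  refine (Finsupp.equivFunOnFinite.trans (Equiv.piCurry fun _ _ => ℕ)).subtypeEquiv fun d => ?_
  rw [weight_eq_iff, funext_iff, ← forall_and]
  rfl

end Counting

section Typed

variable {K : Type} [Field K] {v : ℕ} {n : Fin v → ℕ}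

lemma finrank_eq_card {σ : Type} (s : Set (σ →₀ ℕ)) (V : Submodule K (MvPolynomial σ K))
    (h : ∀ f, f ∈ V ↔ ∀ d ∈ f.support, d ∈ s) [Finite s] : Module.finrank K V = Nat.card s := by
  have hV : V = AddMonoidAlgebra.supported K K s := by
    ext f
    exact (h f).trans Iff.rfl
  have := Fintype.ofFinite s
  rw [hV, (AddMonoidAlgebra.supportedEquivFinsupp (R := K) (S := K) s).finrank_eq,
    Module.finrank_finsupp_self, Nat.card_eq_fintype_card]

lemma mem_homSub_iff {σ : Type} {r : σ → Fin v} {a : Fin v → ℕ} {f : MvPolynomial σ K} :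
    f ∈ homSub K r a ↔ ∀ d ∈ f.support, Finsupp.weight (rowWt r) d = a := by
  rw [mem_homSub]
  exact forall_congr' fun d => by rw [mem_support_iff]

/-- The Hilbert function of an ideal defined by the types of its monomials. -/
lemma hf_of_types {J : Ideal (MvPolynomial (MVar v n) K)} {Δ : Finset (Fin v → ℕ)}
    (hbox : ∀ k ∈ Δ, k ≤ fun i => n i + 1) (h : ∀ f, f ∈ J ↔ ∀ d ∈ f.support, kap d ∉ Δ)
    (a : Fin v → ℕ) : hf Sigma.fst J a = sumG Δ a := by
  classical
  have hfin := finite_weight (Sigma.fst : MVar v n → Fin v) a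
  let A := hfin.toFinset
  have hA : ∀ d, d ∈ A ↔ Finsupp.weight (rowWt (Sigma.fst : MVar v n → Fin v)) d = a := by
    intro d
    simp [A]
  have h1 : Module.finrank K (homSub K (Sigma.fst : MVar v n → Fin v) a) = A.card := by
    rw [finrank_eq_card (A : Set (MVar v n →₀ ℕ)) _ fun f => ?_]
    · simp
    · simp only [mem_homSub_iff, Finset.mem_coe, hA]
  have h2 : Module.finrank K (hPart (Sigma.fst : MVar v n → Fin v) J a) =
      (A.filter fun d => kap d ∉ Δ).card := by
    rw [finrank_eq_card ((A.filter fun d => kap d ∉ Δ : Finset _) : Set (MVar v n →₀ ℕ)) _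
      fun f => ?_]
    · simp
    · rw [Submodule.mem_inf, mem_homSub_iff, Submodule.restrictScalars_mem, h, ← forall_and]
      refine forall_congr' fun d => ?_
      rw [Finset.mem_coe, Finset.mem_filter, hA]
      tauto
  have h3 : (A.filter fun d => kap d ∈ Δ).card = sumG Δ a := by
    rw [Finset.card_eq_sum_card_fiberwise (f := kap) (t := Δ) fun d hd => by
      simpa using (Finset.mem_filter.1 hd).2]
    refine Finset.sum_congr rfl fun k hk => ?_
    rw [← card_kap k a (hbox k hk), ← Nat.card_eq_finsetCard]
    refine Nat.card_congr (Equiv.subtypeEquivRight fun d => ?_)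
    rw [Finset.mem_filter, Finset.mem_filter, hA]
    constructor
    · exact fun h => ⟨h.1.1, h.2⟩
    · exact fun h => ⟨⟨h.1, by rw [h.2]; exact hk⟩, h.2⟩
  have h4 := Finset.card_filter_add_card_filter_not (s := A) fun d => kap d ∈ Δ
  rw [hf, h1, h2, ← h3, ← h4, Nat.add_sub_cancel]

/-- The projection killing all variables outside `T`. -/
def keep (K : Type) [Field K] {σ : Type} (T : Set σ) : MvPolynomial σ K →ₐ[K] MvPolynomial σ K :=
  open Classical in aeval fun s => if s ∈ T then X s else 0

lemma keep_X_of_mem {σ : Type} {T : Set σ} {s : σ} (h : s ∈ T) :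
    keep K T (X s) = X s := by
  rw [keep, aeval_X, if_pos h]

lemma keep_X_of_notMem {σ : Type} {T : Set σ} {s : σ} (h : s ∉ T) :
    keep K T (X s) = 0 := by
  rw [keep, aeval_X, if_neg h]

open Classical in
lemma keep_monomial {σ : Type} (T : Set σ) (d : σ →₀ ℕ) (c : K) :
    keep K T (monomial d c) = if ∀ s, d s ≠ 0 → s ∈ T then monomial d c else 0 := by
  rw [monomial_eq, map_mul, algHom_C, algebraMap_eq, Finsupp.prod, map_prod]
  split_ifs with h
  · congr 1
    refine Finset.prod_congr rfl fun s hs => ?_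
    rw [map_pow, keep_X_of_mem (h s (Finsupp.mem_support_iff.1 hs))]
  · push Not at h
    obtain ⟨s, hs, hsT⟩ := h
    rw [Finset.prod_eq_zero (Finsupp.mem_support_iff.2 hs), mul_zero]
    rw [map_pow, keep_X_of_notMem hsT, zero_pow hs]

open Classical in
lemma coeff_keep {σ : Type} (T : Set σ) (f : MvPolynomial σ K) (d : σ →₀ ℕ) :
    coeff d (keep K T f) = if ∀ s, d s ≠ 0 → s ∈ T then coeff d f else 0 := by
  induction f using MvPolynomial.induction_on' with
  | monomial e c =>
    rw [keep_monomial, apply_ite (coeff d), coeff_zero, coeff_monomial]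
    by_cases h : e = d
    · rw [h]
    · simp [h]
  | add p q hp hq =>
    rw [map_add, coeff_add, hp, hq, coeff_add]
    split_ifs <;> simp

lemma keep_eq_zero_iff {σ : Type} {T : Set σ} {f : MvPolynomial σ K} :
    keep K T f = 0 ↔ ∀ d ∈ f.support, ¬ ∀ s, d s ≠ 0 → s ∈ T := by
  classical
  rw [MvPolynomial.ext_iff]
  refine forall_congr' fun d => ?_
  rw [coeff_keep, coeff_zero, mem_support_iff]
  split_ifs with h
  · exact ⟨fun h0 hd => absurd h0 hd, fun h1 => by_contra fun h2 => h1 h2 h⟩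
  · exact ⟨fun _ _ => h, fun _ => rfl⟩

end Typed

section Borel

variable {K : Type} [Field K] {v : ℕ} {n : Fin v → ℕ}

lemma exists_pow_ne_pow [Infinite K] {a b : ℕ} (h : a ≠ b) : ∃ x : K, x ≠ 0 ∧ x ^ a ≠ x ^ b := by
  have hp : (Polynomial.X ^ a - Polynomial.X ^ b : Polynomial K) ≠ 0 := by
    rw [sub_ne_zero]
    exact fun h' => h (by simpa using congrArg Polynomial.natDegree h')
  obtain ⟨x, hx⟩ := Polynomial.exists_eval_ne_zero_of_natDegree_lt_card
    (Polynomial.X * (Polynomial.X ^ a - Polynomial.X ^ b) : Polynomial K)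
    (mul_ne_zero Polynomial.X_ne_zero hp) (Cardinal.natCast_lt_aleph0.trans_le
      (Cardinal.aleph0_le_mk K))
  simp only [Polynomial.eval_mul, Polynomial.eval_X, Polynomial.eval_sub, Polynomial.eval_pow,
    mul_ne_zero_iff, sub_ne_zero] at hx
  exact ⟨x, hx⟩

/-- Rescaling of the variables. -/
def scale {σ : Type} (t : σ → K) : MvPolynomial σ K →ₐ[K] MvPolynomial σ K :=
  aeval fun s => C (t s) * X s

lemma coeff_scale {σ : Type} (t : σ → K) (f : MvPolynomial σ K) (d : σ →₀ ℕ) :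
    coeff d (scale t f) = (d.prod fun s l => t s ^ l) * coeff d f := by
  classical
  induction f using MvPolynomial.induction_on' with
  | monomial e c =>
    have : scale t (monomial e c) = C (e.prod fun s l => t s ^ l) * monomial e c := by
      rw [scale, aeval_monomial, algebraMap_eq, monomial_eq]
      simp only [mul_pow, Finsupp.prod, map_prod, map_pow, Finset.prod_mul_distrib]
      ring
    rw [this, coeff_C_mul, coeff_monomial]
    split_ifs with h
    · rw [h]
    · simp
  | add p q hp hq => rw [map_add, coeff_add, hp, hq, coeff_add, mul_add]

/-- An ideal stable under rescaling of the variables is a monomial ideal. -/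
lemma monomial_mem_of_scale [Infinite K] {σ : Type} {J : Ideal (MvPolynomial σ K)}
    (hJ : ∀ t : σ → K, (∀ s, t s ≠ 0) → ∀ f ∈ J, scale t f ∈ J) {f : MvPolynomial σ K}
    (hf : f ∈ J) {d : σ →₀ ℕ} (hd : d ∈ f.support) : monomial d (1 : K) ∈ J := by
  classical
  obtain ⟨N, hN⟩ : ∃ N, f.support.card = N := ⟨_, rfl⟩
  induction N using Nat.strong_induction_on generalizing f with
  | _ N ih =>
    by_cases h : ∃ e ∈ f.support, e ≠ d
    · obtain ⟨e, he, hed⟩ := h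
      obtain ⟨s, hs⟩ := Finsupp.ne_iff.1 hed
      obtain ⟨x, hx, hxe⟩ := exists_pow_ne_pow (K := K) hs
      let t : σ → K := fun s' => if s' = s then x else 1
      have ht : ∀ m : σ →₀ ℕ, (m.prod fun s l => t s ^ l) = x ^ m s := by
        intro m
        rw [Finsupp.prod, Finset.prod_eq_single s]
        · simp [t]
        · intro b _ hb
          simp [t, hb]
        · intro h
          simp [Finsupp.notMem_support_iff.1 h]
      have hc : ∀ m, coeff m (scale t f - C (x ^ e s) * f) = (x ^ m s - x ^ e s) * coeff m f := by
        intro m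
        rw [coeff_sub, coeff_scale, ht, coeff_C_mul, sub_mul]
      have hsub : (scale t f - C (x ^ e s) * f).support ⊆ f.support.erase e := by
        intro m hm
        rw [mem_support_iff, hc] at hm
        refine Finset.mem_erase.2 ⟨?_, mem_support_iff.2 (right_ne_zero_of_mul hm)⟩
        rintro rfl
        exact hm (by rw [sub_self, zero_mul])
      refine ih _ ?_ (f := scale t f - C (x ^ e s) * f) ?_ ?_ rfl
      · rw [← hN]
        exact (Finset.card_le_card hsub).trans_lt (Finset.card_erase_lt_of_mem he)
      · refine J.sub_mem (hJ t (fun s' => ?_) f hf) (J.mul_mem_left _ hf)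
        simp only [t]
        split_ifs
        · exact hx
        · exact one_ne_zero
      · rw [mem_support_iff, hc]
        exact mul_ne_zero (sub_ne_zero.2 hxe.symm) (mem_support_iff.1 hd)
    · push Not at h
      have hf1 : f = monomial d (coeff d f) := by
        ext m
        rw [coeff_monomial]
        split_ifs with hm
        · rw [hm]
        · by_contra h0
          exact hm (h m (mem_support_iff.2 h0)).symm
      have h1 : monomial d (1 : K) = C (coeff d f)⁻¹ * f := by
        conv_rhs => rw [hf1]
        rw [C_mul_monomial, coeff_monomial, if_pos rfl,
          inv_mul_cancel₀ (mem_support_iff.1 hd)]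
      rw [h1]
      exact J.mul_mem_left _ hf

lemma BorelFixed.scale_mem {J : Ideal (MvPolynomial (MVar v n) K)} (hJ : BorelFixed J)
    (t : MVar v n → K) (ht : ∀ s, t s ≠ 0) (f) (hf : f ∈ J) : scale t f ∈ J := by
  have h := hJ (fun i => Matrix.diagonal fun j => t ⟨i, j⟩)
    (fun i => by
      rw [Matrix.det_diagonal, isUnit_iff_ne_zero]
      exact Finset.prod_ne_zero_iff.2 fun j _ => ht _)
    (fun i k j hkj => Matrix.diagonal_apply_ne _ hkj.ne')
  have h2 : gAct (fun i => Matrix.diagonal fun j => t ⟨i, j⟩) = scale t := by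
    refine algHom_ext fun s => ?_
    rw [gAct, scale, aeval_X, aeval_X, Finset.sum_eq_single s.2]
    · rw [Matrix.diagonal_apply_eq]
    · intro b _ hb
      rw [Matrix.diagonal_apply_ne _ hb, C_0, zero_mul]
    · simp
  rw [h2] at h
  rw [← h]
  exact Ideal.mem_map_of_mem _ hf

/-- The upper triangular matrices all of whose entries on and above the diagonal are `1`. -/
def upperOnes (K : Type) [Field K] (N : ℕ) : Matrix (Fin N) (Fin N) K :=
  Matrix.of fun k j => if k ≤ j then 1 else 0

lemma isUnit_det_upperOnes (N : ℕ) : IsUnit (upperOnes K N).det := by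
  rw [Matrix.det_of_isUpperTriangular]
  · simp [upperOnes]
  · intro i j hij
    exact if_neg (not_le.2 hij)

lemma monomial_mem_of_kap_le [Infinite K] {J : Ideal (MvPolynomial (MVar v n) K)}
    (hrad : J.IsRadical) (hJ : BorelFixed J) {d e : MVar v n →₀ ℕ}
    (hd : monomial d (1 : K) ∈ J) (hde : kap d ≤ kap e) : monomial e (1 : K) ∈ J := by
  classical
  let g : ∀ i : Fin v, Matrix (Fin (n i + 1)) (Fin (n i + 1)) K := fun i => upperOnes K (n i + 1)
  have hg := hJ g (fun i => isUnit_det_upperOnes _) (fun i k j hkj => if_neg (not_le.2 hkj))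
  have hmem : gAct g (monomial d 1) ∈ J := by
    rw [← hg]
    exact Ideal.mem_map_of_mem _ hd
  let T : Set (MVar v n) := {s | e s ≠ 0}
  have hT : ∀ s, s ∈ T ↔ e s ≠ 0 := fun _ => Iff.rfl
  have hX : ∀ s, d s ≠ 0 → keep K T (gAct g (X s)) ≠ 0 := by
    rintro ⟨i, j⟩ hs
    obtain ⟨l, hl, hlj⟩ : ∃ l : Fin (n i + 1), e ⟨i, l⟩ ≠ 0 ∧ l ≤ j := by
      by_contra! hcon
      have h1 := kap_le_iff.1 hde ⟨i, j⟩ hs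
      have h2 : kap e i ≤ n i - j := by
        refine rowKap_le_iff.2 fun l hl => ?_
        have := hcon l hl
        rw [Fin.lt_def] at this
        omega
      have := j.2
      simp only at h1
      omega
    intro h0
    have h1 := congrArg (coeff (Finsupp.single (⟨i, l⟩ : MVar v n) 1)) h0
    rw [coeff_keep, if_pos, gAct, aeval_X, coeff_sum, Finset.sum_eq_single l, coeff_C_mul,
      coeff_X, coeff_zero] at h1
    · simp [g, upperOnes, hlj] at h1
    · intro b _ hb
      rw [coeff_C_mul, coeff_X, if_neg, mul_zero]
      intro h
      have := (Finsupp.single_left_inj one_ne_zero).1 h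
      exact hb (by simpa using this)
    · simp
    · intro s hs
      rw [hT]
      rw [Finsupp.single_apply] at hs
      split_ifs at hs with h
      · rw [← h]; exact hl
      · exact absurd rfl hs
  have hne : keep K T (gAct g (monomial d 1)) ≠ 0 := by
    rw [monomial_eq, C_1, one_mul, Finsupp.prod, map_prod, map_prod, Finset.prod_ne_zero_iff]
    intro s hs
    rw [map_pow, map_pow]
    exact pow_ne_zero _ (hX s (Finsupp.mem_support_iff.1 hs))
  rw [Ne, keep_eq_zero_iff] at hne
  push Not at hne
  obtain ⟨m, hm, hmT⟩ := hne
  have hmJ := monomial_mem_of_scale hJ.scale_mem hmem hm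
  refine hrad ⟨m.degree, ?_⟩
  rw [monomial_pow, one_pow]
  have hle : m ≤ m.degree • e := by
    intro s
    rw [Finsupp.smul_apply, smul_eq_mul]
    by_cases hs : m s = 0
    · rw [hs]; exact Nat.zero_le _
    · exact (Finsupp.le_degree s m).trans
        (Nat.le_mul_of_pos_right _ (Nat.pos_of_ne_zero (hmT s hs)))
  rw [← tsub_add_cancel_of_le hle, ← one_mul (1 : K), ← monomial_mul]
  exact J.mul_mem_left _ hmJ

end Borel

section Conversion

variable {K : Type} [Field K] {v : ℕ} {n : Fin v → ℕ}

lemma finrank_hPart_eq_hilb (I : Ideal (MvPolynomial (MVar v n) K)) (a : Fin v → ℕ) :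
    Module.finrank K (hPart Sigma.fst I a) = hilb I a := rfl

/-- The Hilbert function of a Cartwright-Sturmfels ideal is a sum of the functions `boxG`. -/
theorem IsCS.hasTypes [Infinite K] {I : Ideal (MvPolynomial (MVar v n) K)} (hI : IsCS I) :
    HasTypes Sigma.fst I := by
  classical
  obtain ⟨-, J, hrad, hJ, hIJ⟩ := hI
  let Δ : Finset (Fin v → ℕ) := (Finset.Iic fun i => n i + 1).filter fun k =>
    ∃ d : MVar v n →₀ ℕ, kap d = k ∧ monomial d (1 : K) ∉ J
  have hΔ : ∀ d : MVar v n →₀ ℕ, kap d ∉ Δ ↔ monomial d (1 : K) ∈ J := by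
    intro d
    rw [Finset.mem_filter, Finset.mem_Iic, not_and]
    constructor
    · intro h
      by_contra hd
      exact h (kap_le d) ⟨d, rfl, hd⟩
    · rintro hd - ⟨e, he, heJ⟩
      exact heJ (monomial_mem_of_kap_le hrad hJ hd he.ge)
  refine ⟨Δ, fun a => ?_⟩
  rw [← hf_of_types (J := J) (Δ := Δ) (fun k hk => Finset.mem_Iic.1 (Finset.mem_filter.1 hk).1)]
  · rw [hf, hf, finrank_hPart_eq_hilb, finrank_hPart_eq_hilb, hIJ a]
  · intro f
    constructor
    · intro hf d hd
      exact (hΔ d).2 (monomial_mem_of_scale hJ.scale_mem hf hd)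
    · intro h
      rw [f.as_sum]
      refine J.sum_mem fun d hd => ?_
      have := J.mul_mem_left (C (coeff d f)) ((hΔ d).1 (h d hd))
      rwa [C_mul_monomial, mul_one] at this

/-- The variables in the last `k i` positions of each row `i`. -/
def tailVars (n k : Fin v → ℕ) : Set (MVar v n) := {s | n s.1 + 1 - (s.2 : ℕ) ≤ k s.1}

/-- The intersection of the primes generated by the complements of the sets `tailVars n k`. -/
def typeIdeal (K : Type) [Field K] (n : Fin v → ℕ) (Δ : Finset (Fin v → ℕ)) :
    Ideal (MvPolynomial (MVar v n) K) :=
  ⨅ k ∈ Δ, RingHom.ker (keep K (tailVars n k))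

lemma mem_typeIdeal {Δ : Finset (Fin v → ℕ)} {f : MvPolynomial (MVar v n) K} :
    f ∈ typeIdeal K n Δ ↔ ∀ k ∈ Δ, keep K (tailVars n k) f = 0 := by
  simp only [typeIdeal, Ideal.mem_iInf, RingHom.mem_ker]

lemma mem_typeIdeal_iff {Δ : Finset (Fin v → ℕ)} (hΔ : ∀ k ∈ Δ, ∀ k', k' ≤ k → k' ∈ Δ)
    {f : MvPolynomial (MVar v n) K} :
    f ∈ typeIdeal K n Δ ↔ ∀ d ∈ f.support, kap d ∉ Δ := by
  have h : ∀ (d : MVar v n →₀ ℕ) (k : Fin v → ℕ),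
      (∀ s, d s ≠ 0 → s ∈ tailVars n k) ↔ kap d ≤ k := fun d k => kap_le_iff.symm
  simp only [mem_typeIdeal, keep_eq_zero_iff, h]
  exact ⟨fun h1 d hd hk => h1 _ hk d hd le_rfl, fun h1 k hk d hd hdk => h1 d hd (hΔ k hk _ hdk)⟩

lemma isRadical_typeIdeal (Δ : Finset (Fin v → ℕ)) : (typeIdeal K n Δ).IsRadical := by
  rintro f ⟨N, hN⟩
  rw [mem_typeIdeal] at hN ⊢
  intro k hk
  have := hN k hk
  rw [map_pow] at this
  exact IsReduced.eq_zero _ ⟨N, this⟩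

lemma keep_gAct {g : ∀ i : Fin v, Matrix (Fin (n i + 1)) (Fin (n i + 1)) K}
    (hg : ∀ (i : Fin v) (k j : Fin (n i + 1)), j < k → g i k j = 0) (k : Fin v → ℕ)
    (f : MvPolynomial (MVar v n) K) :
    keep K (tailVars n k) (gAct g (keep K (tailVars n k) f)) =
      keep K (tailVars n k) (gAct g f) := by
  have : ((keep K (tailVars n k)).comp (gAct g)).comp (keep K (tailVars n k)) =
      (keep K (tailVars n k)).comp (gAct g) := by
    refine algHom_ext fun s => ?_
    simp only [AlgHom.comp_apply]
    by_cases hs : s ∈ tailVars n k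
    · rw [keep_X_of_mem hs]
    · rw [keep_X_of_notMem hs, map_zero, map_zero, gAct, aeval_X, map_sum]
      refine (Finset.sum_eq_zero fun l _ => ?_).symm
      rcases le_or_gt l s.2 with hl | hl
      · rw [map_mul, keep_X_of_notMem, mul_zero]
        intro h
        apply hs
        have h1 : n s.1 + 1 - (l : ℕ) ≤ k s.1 := h
        rw [Fin.le_def] at hl
        change n s.1 + 1 - (s.2 : ℕ) ≤ k s.1
        omega
      · rw [hg _ _ _ hl, C_0, zero_mul, map_zero]
  exact DFunLike.congr_fun this f

lemma map_gAct_typeIdeal_le {g : ∀ i : Fin v, Matrix (Fin (n i + 1)) (Fin (n i + 1)) K}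
    (hg : ∀ (i : Fin v) (k j : Fin (n i + 1)), j < k → g i k j = 0) (Δ : Finset (Fin v → ℕ)) :
    Ideal.map (gAct g) (typeIdeal K n Δ) ≤ typeIdeal K n Δ := by
  refine Ideal.map_le_iff_le_comap.2 fun f hf => ?_
  rw [Ideal.mem_comap, mem_typeIdeal]
  intro k hk
  rw [← keep_gAct hg, mem_typeIdeal.1 hf k hk, map_zero, map_zero]

lemma gAct_gAct (g h : ∀ i : Fin v, Matrix (Fin (n i + 1)) (Fin (n i + 1)) K)
    (f : MvPolynomial (MVar v n) K) :
    gAct g (gAct h f) = gAct (fun i => g i * h i) f := by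
  have : (gAct g).comp (gAct h) = gAct fun i => g i * h i := by
    refine algHom_ext fun s => ?_
    simp only [AlgHom.comp_apply, gAct, aeval_X, map_sum, map_mul, algHom_C, algebraMap_eq,
      Matrix.mul_apply, Finset.sum_mul, Finset.mul_sum]
    rw [Finset.sum_comm]
    refine Finset.sum_congr rfl fun l _ => Finset.sum_congr rfl fun m _ => ?_
    ring
  exact DFunLike.congr_fun this f

lemma gAct_one (f : MvPolynomial (MVar v n) K) : gAct (fun _ => 1) f = f := by
  have : gAct (fun _ => 1) = AlgHom.id K (MvPolynomial (MVar v n) K) := by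
    refine algHom_ext fun s => ?_
    rw [gAct, aeval_X, Finset.sum_eq_single s.2]
    · rw [Matrix.one_apply_eq, C_1, one_mul]; rfl
    · intro b _ hb
      rw [Matrix.one_apply_ne hb, C_0, zero_mul]
    · simp
  exact DFunLike.congr_fun this f

lemma borelFixed_typeIdeal (Δ : Finset (Fin v → ℕ)) : BorelFixed (typeIdeal K n Δ) := by
  intro g hdet hg
  refine le_antisymm (map_gAct_typeIdeal_le hg Δ) fun f hf => ?_
  have hinv : ∀ (i : Fin v) (k j : Fin (n i + 1)), j < k → (g i)⁻¹ k j = 0 := by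
    intro i k j hkj
    have := (g i).invertibleOfIsUnitDet (hdet i)
    have h : Matrix.BlockTriangular (g i) id := fun k j h => hg i k j h
    exact Matrix.blockTriangular_inv_of_blockTriangular h hkj
  have h1 := map_gAct_typeIdeal_le hinv Δ (Ideal.mem_map_of_mem _ hf)
  have h2 := Ideal.mem_map_of_mem (gAct g) h1
  rw [gAct_gAct] at h2
  have h3 : (fun i => g i * (g i)⁻¹) = fun _ => 1 :=
    funext fun i => Matrix.mul_nonsing_inv _ (hdet i)
  rwa [h3, gAct_one] at h2

/-- A multigraded ideal whose Hilbert function is a sum of the functions `boxG` is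
Cartwright-Sturmfels. -/
theorem HasTypes.isCS [Infinite K] {I : Ideal (MvPolynomial (MVar v n) K)}
    (h : HasTypes Sigma.fst I) (hI : MG Sigma.fst I) : IsCS I := by
  classical
  obtain ⟨Δ, hΔ⟩ := h
  have hmem := mem_iff_not_van hI hΔ
  have hlow : ∀ k ∈ Δ, ∀ k', k' ≤ k → k' ∈ Δ := fun k hk k' hk' =>
    (hmem k').2 fun hV => (hmem k).1 hk (hV.mono_right hk')
  have hbox : ∀ k ∈ Δ, k ≤ fun i => n i + 1 := by
    intro k hk i
    by_contra hki
    have hki' : ¬ k i ≤ n i + 1 := hki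
    refine (hmem k).1 hk (Van.of_card_lt (i := i)
      (Finset.univ.image fun j : Fin (n i + 1) => (⟨i, j⟩ : MVar v n)) ?_ ?_ ?_)
    · intro s hs
      obtain ⟨j, -, rfl⟩ := Finset.mem_image.1 hs
      rfl
    · refine rowIdeal_le.2 fun s hs => Ideal.mem_sup_right (Ideal.subset_span ⟨s, ?_, rfl⟩)
      obtain ⟨i', j⟩ := s
      obtain rfl : i' = i := hs
      simp
    · have := Finset.card_image_le (s := Finset.univ)
        (f := fun j : Fin (n i + 1) => (⟨i, j⟩ : MVar v n))
      rw [Finset.card_univ, Fintype.card_fin] at this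
      omega
  refine ⟨hI, typeIdeal K n Δ, isRadical_typeIdeal Δ, borelFixed_typeIdeal Δ, fun a => ?_⟩
  have h1 := hf_of_types hbox (fun f => mem_typeIdeal_iff (K := K) (n := n) hlow (f := f)) a
  have h2 := finrank_hPart_add_hf Sigma.fst I a
  have h3 := finrank_hPart_add_hf Sigma.fst (typeIdeal K n Δ) a
  rw [hΔ, finrank_hPart_eq_hilb] at h2
  rw [h1, finrank_hPart_eq_hilb] at h3
  omega

end Conversion

section Quotient

variable {K : Type} [Field K] {v : ℕ} {σ σ' : Type} {r : σ → Fin v} {r' : σ' → Fin v}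

lemma GradedHom.MG_of_comap {θ : MvPolynomial σ' K →ₐ[K] MvPolynomial σ K}
    (hθ : GradedHom r' r θ) (hs : Function.Surjective θ) {I : Ideal (MvPolynomial σ K)}
    (hI : MG r' (I.comap θ)) : MG r I := by
  intro f hf a
  obtain ⟨p, rfl⟩ := hs f
  rw [hθ.component]
  exact hI p hf a

lemma HasTypes.of_comap [Finite σ] [Finite σ'] {θ : MvPolynomial σ' K →ₐ[K] MvPolynomial σ K}
    (hθ : GradedHom r' r θ) (hs : Function.Surjective θ) {I : Ideal (MvPolynomial σ K)}
    (h : HasTypes r' (I.comap θ)) : HasTypes r I := by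
  obtain ⟨Δ, hΔ⟩ := h
  exact ⟨Δ, fun a => by rw [← hθ.hf_comap hs, hΔ]⟩

end Quotient

end CSPaper

open CSPaper

/-- **Closure properties (5)-(6).** Let `I` be a Cartwright-Sturmfels ideal of `S` and `L`
a `ℤ^v`-graded linear form.  Then `I + (L)` is Cartwright-Sturmfels, the image of
`I + (L)` in `S/(L)` is a Cartwright-Sturmfels ideal of `S/(L)` (under any identification
of `S/(L)` with a standard `ℤ^v`-graded polynomial ring), and for any `K`-subspaces
`U_i ⊆ S_{e_i}` the ideal `I ∩ K[U_1,…,U_v]` is a Cartwright-Sturmfels ideal of the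
polynomial ring `K[U_1,…,U_v]` (realized as the preimage of `I` under any injective graded
`K`-algebra map whose variables go to forms of degree `e_i`). -/
theorem CS_closure_sum_quotient_subring
    {K : Type} [Field K] [Infinite K] {v : ℕ} {n : Fin v → ℕ}
    (I : Ideal (MvPolynomial (MVar v n) K)) (hI : IsCS I)
    (L : MvPolynomial (MVar v n) K) (hL0 : L ≠ 0)
    (hL : ∃ i : Fin v, L.IsWeightedHomogeneous (wt v n) (Pi.single i 1)) :
    IsCS (I ⊔ Ideal.span {L}) ∧
    (∀ (n₂ : Fin v → ℕ)
      (ψ : (MvPolynomial (MVar v n) K ⧸ Ideal.span {L}) ≃ₐ[K]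
        MvPolynomial (MVar v n₂) K),
      IsGradedStructureIso (Ideal.span {L}) ψ →
      IsCS (Ideal.map ψ (Ideal.map (Ideal.Quotient.mk (Ideal.span {L}))
        (I ⊔ Ideal.span {L})))) ∧
    (∀ (n₂ : Fin v → ℕ)
      (φ : MvPolynomial (MVar v n₂) K →ₐ[K] MvPolynomial (MVar v n) K),
      Function.Injective φ →
      (∀ p : MVar v n₂, (φ (X p)).IsWeightedHomogeneous (wt v n) (Pi.single p.1 1)) →
      IsCS (Ideal.comap φ I)) := by
  obtain ⟨i, hL⟩ := hL
  have hMG : MG Sigma.fst I := hI.1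
  have hL' : L ∈ homSub K (Sigma.fst : MVar v n → Fin v) (Pi.single i 1) := hL
  have hsumMG : MG Sigma.fst (I ⊔ Ideal.span {L}) := hMG.sup_span hL'
  have hsum : HasTypes Sigma.fst (I ⊔ Ideal.span {L}) := hI.hasTypes.sup_span hMG hL'
  refine ⟨hsum.isCS hsumMG, fun n₂ ψ hψ => ?_, fun n₂ φ _ hφ => ?_⟩
  · let π : MvPolynomial (MVar v n) K →ₐ[K] MvPolynomial (MVar v n₂) K :=
      (ψ : _ →ₐ[K] _).comp (Ideal.Quotient.mkₐ K (Ideal.span {L}))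
    have hπ : ∀ f, π f = ψ (Ideal.Quotient.mk (Ideal.span {L}) f) := fun _ => rfl
    have hgr : GradedHom Sigma.fst Sigma.fst π := fun s => hψ _ _ (X_mem_homSub Sigma.fst s)
    have hsurj : Function.Surjective π := ψ.surjective.comp Ideal.Quotient.mk_surjective
    have hcomap : Ideal.comap π (Ideal.map ψ (Ideal.map (Ideal.Quotient.mk (Ideal.span {L}))
        (I ⊔ Ideal.span {L}))) = I ⊔ Ideal.span {L} := by
      ext f
      rw [Ideal.mem_comap, hπ, Ideal.mem_map_iff_of_surjective ψ ψ.surjective]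
      constructor
      · rintro ⟨y, hy, hyf⟩
        rw [ψ.injective hyf, Ideal.mem_quotient_iff_mem le_sup_right] at hy
        exact hy
      · exact fun hf => ⟨_, Ideal.mem_map_of_mem _ hf, rfl⟩
    rw [← hcomap] at hsum hsumMG
    exact (HasTypes.of_comap hgr hsurj hsum).isCS (hgr.MG_of_comap hsurj hsumMG)
  · have hgr : GradedHom Sigma.fst Sigma.fst φ := hφ
    exact (hI.hasTypes.comap_graded hMG hgr).isCS (hgr.MG_comap hMG)

end
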